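/- Every period (a real number expressible as an absolutely convergent integral of a rational function with rational coefficients over a domain in ℝ^n defined by polynomial inequalities with rational coefficients) is a computable real number. -/

import Mathlib

/-- A real number is computable if a computable sequence of rationals
approximates it with error `< 2 ^ (-n)`. -/
def IsComputableReal (x : ℝ) : Prop :=
  ∃ f : ℕ → ℚ, Computable f ∧ ∀ n : ℕ, |x - (f n : ℝ)| < (2 : ℝ) ^ (-(n : ℤ))
open MeasureTheory in
/-- `x` is a period: an absolutely convergent integral of a rational function
with rational coefficients over a domain in `ℝⁿ` cut out by finitely many
polynomial inequalities with rational coefficients. -/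
def IsPeriod (x : ℝ) : Prop :=
  ∃ (n : ℕ) (f g : MvPolynomial (Fin n) ℚ) (ps : List (MvPolynomial (Fin n) ℚ)),
    IntegrableOn
      (fun v : Fin n → ℝ => (MvPolynomial.aeval v) f / (MvPolynomial.aeval v) g)
      {v : Fin n → ℝ | ∀ P ∈ ps, 0 ≤ (MvPolynomial.aeval v) P} volume ∧
    x = ∫ v in {v : Fin n → ℝ | ∀ P ∈ ps, 0 ≤ (MvPolynomial.aeval v) P},
      (MvPolynomial.aeval v) f / (MvPolynomial.aeval v) g


namespace PeriodAux

/-- code of a rational number in the underlying encoding -/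
def ratCode (q : ℚ) : ℕ := @Encodable.encode ℚ Rat.instEncodable q

theorem ratCode_eq (q : ℚ) : ratCode q = Nat.pair (Equiv.intEquivNat q.num) q.den := by
  rfl

/-- the set of codes -/
def isCode (k : ℕ) : Prop := 0 < k.unpair.2 ∧ Nat.gcd ((k.unpair.1 + 1) / 2) k.unpair.2 = 1

instance : DecidablePred isCode := fun k => by unfold isCode; infer_instance

theorem natAbs_intEquiv (z : ℤ) : (Equiv.intEquivNat z + 1) / 2 = z.natAbs := by
  rcases z with n | n
  · change (2 * n + 1) / 2 = n; omega
  · change (2 * n + 1 + 1) / 2 = n + 1; omega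

theorem isCode_ratCode (q : ℚ) : isCode (ratCode q) := by
  rw [ratCode_eq, isCode]
  simp only [Nat.unpair_pair]
  rw [natAbs_intEquiv]
  exact ⟨q.den_pos, q.reduced⟩

theorem exists_of_isCode {k : ℕ} (h : isCode k) : ∃ q : ℚ, ratCode q = k := by
  obtain ⟨z, hz⟩ := Equiv.intEquivNat.surjective k.unpair.1
  obtain ⟨h1, h2⟩ := h
  rw [← hz, natAbs_intEquiv] at h2
  refine ⟨⟨z, k.unpair.2, h1.ne', h2⟩, ?_⟩
  rw [ratCode_eq]
  simp only [hz, Nat.pair_unpair]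

theorem encode_rat (q : ℚ) : @Encodable.encode ℚ Rat.instDenumerable.toEncodable q
    = Nat.count isCode (ratCode q) := by
  classical
  rw [Nat.count_eq_card_filter_range]
  have : @Encodable.encode ℚ Rat.instDenumerable.toEncodable q =
    (List.range (ratCode q)).countP (fun k => @decide (k ∈ Set.range (@Encodable.encode ℚ Rat.instEncodable)) 
      (@Encodable.decidableRangeEncode ℚ Rat.instEncodable k)) := by
    rfl
  rw [this, List.countP_eq_length_filter]
  change _ = ((Multiset.range (ratCode q)).filter isCode).card
  change _ = (((List.range (ratCode q)).filter isCode)).length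
  congr 1
  apply List.filter_congr
  intro k _
  rw [decide_eq_decide]
  constructor
  · rintro ⟨q, rfl⟩; exact isCode_ratCode q
  · intro h; obtain ⟨q, hq⟩ := exists_of_isCode h; exact ⟨q, hq⟩

theorem primrec_gcd : Primrec₂ Nat.gcd := by
  have h : PrimrecRel (fun (p : ℕ × ℕ) (c : ℕ) => p.1 % c = 0 ∧ p.2 % c = 0) := by
    apply PrimrecPred.and
    · exact Primrec.eq.comp (Primrec.nat_mod.comp (Primrec.fst.comp Primrec.fst) Primrec.snd) (Primrec.const 0)
    · exact Primrec.eq.comp (Primrec.nat_mod.comp (Primrec.snd.comp Primrec.fst) Primrec.snd) (Primrec.const 0)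
  have h2 := Primrec.nat_findGreatest (f := fun p : ℕ × ℕ => p.1 + p.2) (Primrec.nat_add.comp Primrec.fst Primrec.snd) h
  refine h2.of_eq ?_
  rintro ⟨a, b⟩
  simp only
  rw [Nat.findGreatest_eq_iff]
  refine ⟨?_, ?_, ?_⟩
  · rcases Nat.eq_zero_or_pos a with rfl | ha
    · simp
    · have := Nat.gcd_le_left b ha; omega
  · intro _
    exact ⟨Nat.mod_eq_zero_of_dvd (Nat.gcd_dvd_left _ _), Nat.mod_eq_zero_of_dvd (Nat.gcd_dvd_right _ _)⟩
  · rintro n hn1 hn2 ⟨h1, h2⟩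
    have h3 := Nat.dvd_gcd (Nat.dvd_of_mod_eq_zero h1) (Nat.dvd_of_mod_eq_zero h2)
    have : 0 < Nat.gcd a b := by
      rcases Nat.eq_zero_or_pos (Nat.gcd a b) with h | h
      · rw [Nat.gcd_eq_zero_iff] at h; omega
      · exact h
    have := Nat.le_of_dvd this h3
    omega

theorem primrec_isCode : PrimrecPred isCode := by
  have h1 : Primrec (fun k : ℕ => k.unpair.1) := Primrec.fst.comp Primrec.unpair
  have h2 : Primrec (fun k : ℕ => k.unpair.2) := Primrec.snd.comp Primrec.unpair
  refine PrimrecPred.and (Primrec.nat_lt.comp (Primrec.const 0) h2) ?_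
  exact Primrec.eq.comp (primrec_gcd.comp (Primrec.nat_div.comp (Primrec.succ.comp h1) (Primrec.const 2)) h2) (Primrec.const 1)

theorem primrec_count : Primrec (Nat.count isCode) := by
  have h : Primrec₂ (fun (_ : Unit) (n : ℕ) => (Nat.rec 0 (fun n IH => if isCode n then IH + 1 else IH) n : ℕ)) := by
    refine Primrec.nat_rec (f := fun _ => 0) (g := fun _ p => if isCode p.1 then p.2 + 1 else p.2) (Primrec.const 0) ?_
    have h1 : Primrec (fun x : Unit × ℕ × ℕ => x.2.1) := Primrec.fst.comp Primrec.snd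
    have h2 : Primrec (fun x : Unit × ℕ × ℕ => x.2.2) := Primrec.snd.comp Primrec.snd
    exact Primrec.ite (primrec_isCode.comp h1) (Primrec.succ.comp h2) h2
  refine (h.comp (Primrec.const ()) Primrec.id).of_eq ?_
  intro n
  simp only [id]
  induction n with
  | zero => rfl
  | succ n ih =>
    rw [Nat.count_succ]
    simp only
    rw [ih]
    split_ifs <;> rfl

/-- computable rational valued function, as quotients of differences -/
def CompQ {α : Type} [Primcodable α] (f : α → ℚ) : Prop :=
  ∃ a b d : α → ℕ, Primrec a ∧ Primrec b ∧ Primrec d ∧ (∀ x, 0 < d x) ∧ ∀ x, f x = ((a x : ℚ) - b x) / d x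

theorem CompQ.computable {f : ℕ → ℚ} (hf : CompQ f) : Computable f := by
  obtain ⟨a, b, d, ha, hb, hd, hd0, h⟩ := hf
  let P : ℕ → ℕ → Prop := fun N k => isCode k ∧
    if k.unpair.1 % 2 = 0 then (k.unpair.1 / 2) * d N + b N * k.unpair.2 = a N * k.unpair.2
    else a N * k.unpair.2 + (k.unpair.1 + 1) / 2 * d N = b N * k.unpair.2
  have hPdec : DecidableRel P := fun N k => by
    simp only [P]; infer_instance
  have hP : PrimrecPred (fun p : ℕ × ℕ => P p.1 p.2) := by
    have h1 : Primrec (fun k : ℕ × ℕ => k.2.unpair.1) := Primrec.fst.comp (Primrec.unpair.comp Primrec.snd)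
    have h2 : Primrec (fun k : ℕ × ℕ => k.2.unpair.2) := Primrec.snd.comp (Primrec.unpair.comp Primrec.snd)
    have hA := ha.comp (Primrec.fst (α := ℕ) (β := ℕ))
    have hB := hb.comp (Primrec.fst (α := ℕ) (β := ℕ))
    have hD := hd.comp (Primrec.fst (α := ℕ) (β := ℕ))
    have c1 : PrimrecPred (fun k : ℕ × ℕ => k.2.unpair.1 % 2 = 0) :=
      Primrec.eq.comp (Primrec.nat_mod.comp h1 (Primrec.const 2)) (Primrec.const 0)
    have c2 : PrimrecPred (fun p : ℕ × ℕ => (p.2.unpair.1 / 2) * d p.1 + b p.1 * p.2.unpair.2 = a p.1 * p.2.unpair.2) :=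
      Primrec.eq.comp (Primrec.nat_add.comp (Primrec.nat_mul.comp (Primrec.nat_div.comp h1 (Primrec.const 2)) hD)
        (Primrec.nat_mul.comp hB h2)) (Primrec.nat_mul.comp hA h2)
    have c3 : PrimrecPred (fun p : ℕ × ℕ => a p.1 * p.2.unpair.2 + (p.2.unpair.1 + 1) / 2 * d p.1 = b p.1 * p.2.unpair.2) :=
      Primrec.eq.comp (Primrec.nat_add.comp (Primrec.nat_mul.comp hA h2)
        (Primrec.nat_mul.comp (Primrec.nat_div.comp (Primrec.succ.comp h1) (Primrec.const 2)) hD)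
        ) (Primrec.nat_mul.comp hB h2)
    refine (((primrec_isCode.comp Primrec.snd).and ((c1.and c2).or (c1.not.and c3)))).of_eq ?_
    intro p
    simp only [P]
    split_ifs with h <;> simp [h]
  have key : ∀ N q, P N (ratCode q) ↔ q = f N := by
    intro N q
    simp only [P, isCode_ratCode, true_and]
    rw [h, ratCode_eq]
    simp only [Nat.unpair_pair]
    have hq : (q.den : ℚ) ≠ 0 := by exact_mod_cast q.den_pos.ne'
    have hdN : (d N : ℚ) ≠ 0 := by exact_mod_cast (hd0 N).ne'
    have e1 : q = ((a N : ℚ) - b N) / d N ↔ (q.num : ℚ) * d N = (a N - b N) * q.den := by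
      rw [eq_div_iff hdN]
      conv_lhs => rw [← Rat.num_div_den q]
      rw [div_mul_eq_mul_div, div_eq_iff hq]
    rw [e1]
    have e2 : (q.num : ℚ) * d N = (a N - b N) * q.den ↔ q.num * (d N : ℤ) = (a N - b N) * q.den := by
      exact_mod_cast Iff.rfl
    rw [e2]
    rcases hz : q.num with n | n
    · have : Equiv.intEquivNat (Int.ofNat n) = 2 * n := rfl
      rw [this, if_pos (by omega), show 2 * n / 2 = n by omega]
      zify
      constructor <;> intro h <;> simp only [Int.ofNat_eq_natCast] at * <;> linarith
    · have : Equiv.intEquivNat (Int.negSucc n) = 2 * n + 1 := rfl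
      rw [this, if_neg (by omega), show (2 * n + 1 + 1) / 2 = n + 1 by omega]
      zify
      constructor <;> intro h <;> simp only [Int.negSucc_eq] at * <;> linarith
  have hex : ∀ N, ∃ k, P N k := fun N => ⟨ratCode (f N), (key N _).2 rfl⟩
  have hc := Computable.find (P := P) hP.computablePred hex
  have hfind : ∀ N, Nat.find (hex N) = ratCode (f N) := by
    intro N
    have h1 := Nat.find_spec (hex N)
    obtain ⟨q, hq⟩ := exists_of_isCode h1.1
    rw [← hq] at h1 ⊢
    rw [(key N q).1 h1]
  rw [← Computable.encode_iff]
  refine (primrec_count.to_comp.comp hc).of_eq ?_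
  intro N
  rw [hfind]
  exact (encode_rat _).symm

end PeriodAux


namespace PeriodAux

section
variable {α : Type} [Primcodable α]

theorem CompQ.of_eq {f g : α → ℚ} (hf : CompQ f) (h : ∀ x, f x = g x) : CompQ g := by
  rwa [← funext h]

theorem CompQ.natCast {a : α → ℕ} (ha : Primrec a) : CompQ (fun x => (a x : ℚ)) :=
  ⟨a, fun _ => 0, fun _ => 1, ha, Primrec.const 0, Primrec.const 1, fun _ => one_pos, fun x => by simp⟩

theorem CompQ.const (q : ℚ) : CompQ (fun _ : α => q) := by
  refine ⟨fun _ => q.num.toNat, fun _ => (-q.num).toNat, fun _ => q.den, Primrec.const _, Primrec.const _,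
    Primrec.const _, fun _ => q.den_pos, fun x => ?_⟩
  have h1 := Int.toNat_sub_toNat_neg q.num
  have h2 : ((q.num.toNat : ℚ) - ((-q.num).toNat : ℚ)) = (q.num : ℚ) := by
    conv_rhs => rw [← h1]
    push_cast
    rfl
  simp only
  rw [h2, Rat.num_div_den]

theorem CompQ.add {f g : α → ℚ} (hf : CompQ f) (hg : CompQ g) : CompQ (fun x => f x + g x) := by
  obtain ⟨a, b, d, ha, hb, hd, h0, h⟩ := hf
  obtain ⟨a', b', d', ha', hb', hd', h0', h'⟩ := hg
  refine ⟨fun x => a x * d' x + a' x * d x, fun x => b x * d' x + b' x * d x, fun x => d x * d' x,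
    Primrec.nat_add.comp (Primrec.nat_mul.comp ha hd') (Primrec.nat_mul.comp ha' hd),
    Primrec.nat_add.comp (Primrec.nat_mul.comp hb hd') (Primrec.nat_mul.comp hb' hd),
    Primrec.nat_mul.comp hd hd', fun x => Nat.mul_pos (h0 x) (h0' x), fun x => ?_⟩
  have := (h0 x).ne'; have := (h0' x).ne'
  simp only [h, h']; push_cast; field_simp; ring

theorem CompQ.mul {f g : α → ℚ} (hf : CompQ f) (hg : CompQ g) : CompQ (fun x => f x * g x) := by
  obtain ⟨a, b, d, ha, hb, hd, h0, h⟩ := hf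
  obtain ⟨a', b', d', ha', hb', hd', h0', h'⟩ := hg
  refine ⟨fun x => a x * a' x + b x * b' x, fun x => a x * b' x + b x * a' x, fun x => d x * d' x,
    Primrec.nat_add.comp (Primrec.nat_mul.comp ha ha') (Primrec.nat_mul.comp hb hb'),
    Primrec.nat_add.comp (Primrec.nat_mul.comp ha hb') (Primrec.nat_mul.comp hb ha'),
    Primrec.nat_mul.comp hd hd', fun x => Nat.mul_pos (h0 x) (h0' x), fun x => ?_⟩
  have := (h0 x).ne'; have := (h0' x).ne'
  simp only [h, h']; push_cast; field_simp; ring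

theorem CompQ.neg {f : α → ℚ} (hf : CompQ f) : CompQ (fun x => - f x) :=
  ((CompQ.const (-1)).mul hf).of_eq (fun x => by ring)

theorem CompQ.sub {f g : α → ℚ} (hf : CompQ f) (hg : CompQ g) : CompQ (fun x => f x - g x) :=
  (hf.add hg.neg).of_eq (fun x => by ring)

theorem CompQ.primrecPred_lt {f g : α → ℚ} (hf : CompQ f) (hg : CompQ g) : PrimrecPred (fun x => f x < g x) := by
  obtain ⟨a, b, d, ha, hb, hd, h0, h⟩ := hf
  obtain ⟨a', b', d', ha', hb', hd', h0', h'⟩ := hg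
  refine (Primrec.nat_lt.comp
    (Primrec.nat_add.comp (Primrec.nat_mul.comp ha hd') (Primrec.nat_mul.comp hb' hd))
    (Primrec.nat_add.comp (Primrec.nat_mul.comp ha' hd) (Primrec.nat_mul.comp hb hd'))).of_eq fun x => ?_
  rw [h, h', div_lt_div_iff₀ (by exact_mod_cast h0 x) (by exact_mod_cast h0' x)]
  rw [← Nat.cast_lt (α := ℚ)]
  push_cast
  constructor <;> intro h <;> linarith

theorem CompQ.ite {f g : α → ℚ} {c : α → Prop} [DecidablePred c] (hc : PrimrecPred c)
    (hf : CompQ f) (hg : CompQ g) : CompQ (fun x => if c x then f x else g x) := by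
  obtain ⟨a, b, d, ha, hb, hd, h0, h⟩ := hf
  obtain ⟨a', b', d', ha', hb', hd', h0', h'⟩ := hg
  refine ⟨_, _, _, Primrec.ite hc ha ha', Primrec.ite hc hb hb', Primrec.ite hc hd hd', fun x => ?_, fun x => ?_⟩
  · split_ifs <;> simp [h0, h0']
  · simp only; split_ifs <;> simp only [h, h']

theorem CompQ.inv {f : α → ℚ} (hf : CompQ f) : CompQ (fun x => (f x)⁻¹) := by
  have hf' := hf
  obtain ⟨a, b, d, ha, hb, hd, h0, h⟩ := hf
  have h1 : CompQ (fun x => (d x : ℚ) / ((a x - b x - 1 + 1 : ℕ) : ℚ)) :=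
    ⟨d, fun _ => 0, fun x => a x - b x - 1 + 1, hd, Primrec.const 0,
      Primrec.succ.comp (Primrec.nat_sub.comp (Primrec.nat_sub.comp ha hb) (Primrec.const 1)),
      fun x => Nat.succ_pos _, fun x => by simp⟩
  have h2 : CompQ (fun x => -(d x : ℚ) / ((b x - a x - 1 + 1 : ℕ) : ℚ)) :=
    ⟨fun _ => 0, d, fun x => b x - a x - 1 + 1, Primrec.const 0, hd,
      Primrec.succ.comp (Primrec.nat_sub.comp (Primrec.nat_sub.comp hb ha) (Primrec.const 1)),
      fun x => Nat.succ_pos _, fun x => by simp⟩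
  refine (CompQ.ite (Primrec.nat_lt.comp hb ha) h1 (CompQ.ite (Primrec.nat_lt.comp ha hb) h2 (CompQ.const 0))).of_eq fun x => ?_
  rw [h, inv_div]
  split_ifs with c1 c2
  · rw [show a x - b x - 1 + 1 = a x - b x by omega, Nat.cast_sub c1.le]
  · rw [show b x - a x - 1 + 1 = b x - a x by omega, Nat.cast_sub c2.le, ← neg_sub (b x : ℚ), div_neg, neg_div]
  · rw [show a x = b x by omega]; simp

theorem CompQ.div {f g : α → ℚ} (hf : CompQ f) (hg : CompQ g) : CompQ (fun x => f x / g x) :=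
  (hf.mul hg.inv).of_eq (fun x => by rw [div_eq_mul_inv])

theorem CompQ.max {f g : α → ℚ} (hf : CompQ f) (hg : CompQ g) : CompQ (fun x => max (f x) (g x)) := by
  refine (CompQ.ite (hf.primrecPred_lt hg) hg hf).of_eq fun x => ?_
  split_ifs with h
  · rw [max_eq_right h.le]
  · rw [max_eq_left (not_lt.1 h)]

theorem CompQ.pow {f : α → ℚ} (hf : CompQ f) (m : ℕ) : CompQ (fun x => f x ^ m) := by
  induction m with
  | zero => simpa using CompQ.const 1
  | succ m ih => simpa only [pow_succ] using ih.mul hf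

theorem CompQ.comp {β : Type} [Primcodable β] {f : α → ℚ} (hf : CompQ f) {e : β → α} (he : Primrec e) :
    CompQ (fun x => f (e x)) := by
  obtain ⟨a, b, d, ha, hb, hd, h0, h⟩ := hf
  exact ⟨_, _, _, ha.comp he, hb.comp he, hd.comp he, fun x => h0 _, fun x => h _⟩

theorem CompQ.eval {n : ℕ} (p : MvPolynomial (Fin n) ℚ) {v : α → Fin n → ℚ} (hv : ∀ i, CompQ (fun x => v x i)) :
    CompQ (fun x => MvPolynomial.eval (v x) p) := by
  induction p using MvPolynomial.induction_on with
  | C a => simpa using CompQ.const a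
  | add p q hp hq => simpa using hp.add hq
  | mul_X p i hp => simpa using hp.mul (hv i)

theorem CompQ.sum {f : α × ℕ → ℚ} (hf : CompQ f) {M : α → ℕ} (hM : Primrec M) :
    CompQ (fun x => ∑ t ∈ Finset.range (M x), f (x, t)) := by
  obtain ⟨a, b, d, ha, hb, hd, h0, h⟩ := hf
  let R : α → ℕ → ℕ × ℕ × ℕ := fun x m => Nat.rec (0, 0, 1) (fun t IH =>
    (IH.1 * d (x, t) + a (x, t) * IH.2.2, IH.2.1 * d (x, t) + b (x, t) * IH.2.2, IH.2.2 * d (x, t))) m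
  have hR : Primrec₂ R := by
    refine Primrec.nat_rec (f := fun _ => (0, 0, 1)) (g := fun x p =>
      (p.2.1 * d (x, p.1) + a (x, p.1) * p.2.2.2, p.2.2.1 * d (x, p.1) + b (x, p.1) * p.2.2.2, p.2.2.2 * d (x, p.1)))
      (Primrec.const _) ?_
    have hxt : Primrec (fun y : α × ℕ × ℕ × ℕ × ℕ => (y.1, y.2.1)) :=
      Primrec.pair Primrec.fst (Primrec.fst.comp Primrec.snd)
    have i0 : Primrec (fun y : α × ℕ × ℕ × ℕ × ℕ => y.2.2) := Primrec.snd.comp Primrec.snd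
    have i1 : Primrec (fun y : α × ℕ × ℕ × ℕ × ℕ => y.2.2.1) := Primrec.fst.comp i0
    have i2 : Primrec (fun y : α × ℕ × ℕ × ℕ × ℕ => y.2.2.2.1) := Primrec.fst.comp (Primrec.snd.comp i0)
    have i3 : Primrec (fun y : α × ℕ × ℕ × ℕ × ℕ => y.2.2.2.2) := Primrec.snd.comp (Primrec.snd.comp i0)
    have hD := hd.comp hxt
    have hA := ha.comp hxt
    have hB := hb.comp hxt
    exact Primrec.pair (Primrec.nat_add.comp (Primrec.nat_mul.comp i1 hD) (Primrec.nat_mul.comp hA i3))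
      (Primrec.pair (Primrec.nat_add.comp (Primrec.nat_mul.comp i2 hD) (Primrec.nat_mul.comp hB i3))
      (Primrec.nat_mul.comp i3 hD))
  have hR' : Primrec (fun x => R x (M x)) := hR.comp Primrec.id hM
  have key : ∀ x m, 0 < (R x m).2.2 ∧ ∑ t ∈ Finset.range m, f (x, t) = (((R x m).1 : ℚ) - (R x m).2.1) / (R x m).2.2 := by
    intro x m
    induction m with
    | zero => simp [R]
    | succ m ih =>
      obtain ⟨ih1, ih2⟩ := ih
      have e : R x (m+1) = ((R x m).1 * d (x, m) + a (x, m) * (R x m).2.2,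
        (R x m).2.1 * d (x, m) + b (x, m) * (R x m).2.2, (R x m).2.2 * d (x, m)) := rfl
      rw [e]
      refine ⟨Nat.mul_pos ih1 (h0 _), ?_⟩
      rw [Finset.sum_range_succ, ih2, h]
      have := (h0 (x, m)).ne'
      have := ih1.ne'
      push_cast; field_simp; ring
  exact ⟨_, _, _, Primrec.fst.comp hR', Primrec.fst.comp (Primrec.snd.comp hR'), Primrec.snd.comp (Primrec.snd.comp hR'),
    fun x => (key x _).1, fun x => (key x _).2⟩

theorem primrec_pow {a b : α → ℕ} (ha : Primrec a) (hb : Primrec b) : Primrec (fun x => a x ^ b x) := by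
  have h : Primrec₂ (fun (x : ℕ) (n : ℕ) => (Nat.rec 1 (fun _ IH => IH * x) n : ℕ)) :=
    Primrec.nat_rec (f := fun _ => 1) (g := fun x p => p.2 * x) (Primrec.const 1)
      (Primrec.nat_mul.comp (Primrec.snd.comp Primrec.snd) Primrec.fst)
  refine (h.comp ha hb).of_eq fun x => ?_
  generalize b x = n
  induction n with
  | zero => rfl
  | succ n ih => rw [pow_succ, ← ih]

end

/-- approximable with error `K / k` -/
def Appr (x : ℝ) : Prop :=
  ∃ g : ℕ → ℚ, CompQ g ∧ ∃ K : ℝ, ∀ k : ℕ, 1 ≤ k → |x - (g k : ℝ)| ≤ K / k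

theorem Appr.sub {x y : ℝ} (hx : Appr x) (hy : Appr y) : Appr (x - y) := by
  obtain ⟨g, hg, K, hK⟩ := hx
  obtain ⟨g', hg', K', hK'⟩ := hy
  refine ⟨_, hg.sub hg', K + K', fun k hk => ?_⟩
  have h1 := hK k hk
  have h2 := hK' k hk
  rw [add_div]
  push_cast
  calc _ = |(x - g k) - (y - g' k)| := by ring_nf
    _ ≤ _ := (abs_sub _ _).trans (add_le_add h1 h2)

theorem Appr.exists_computable {x : ℝ} (hx : Appr x) :
    ∃ f : ℕ → ℚ, Computable f ∧ ∀ n : ℕ, |x - (f n : ℝ)| < (2 : ℝ) ^ (-(n : ℤ)) := by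
  obtain ⟨g, hg, K, hK⟩ := hx
  obtain ⟨C, hC⟩ := exists_nat_gt K
  have hp : Primrec (fun n : ℕ => (C + 1) * 2 ^ n) :=
    Primrec.nat_mul.comp (Primrec.const _) (primrec_pow (Primrec.const 2) Primrec.id)
  refine ⟨_, (hg.comp hp).computable, fun n => (hK _ ?_).trans_lt ?_⟩
  · exact Nat.mul_pos (Nat.succ_pos _) (by positivity)
  · push_cast
    rw [div_lt_iff₀ (by positivity), zpow_neg, zpow_natCast]
    field_simp
    linarith

end PeriodAux


namespace PeriodAux
open MvPolynomial

section alg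
variable {n : ℕ} {R : Type*} [CommRing R]

/-- numerator of the derivative of `p * B^(-r) * (A/B)^τ` -/
noncomputable def nab (A B : MvPolynomial (Fin n) R) (i : Fin n) (r : ℕ) (τ : R) (p : MvPolynomial (Fin n) R) :
    MvPolynomial (Fin n) R :=
  A * (B * pderiv i p - C (r : R) * p * pderiv i B) + C τ * p * (B * pderiv i A - A * pderiv i B)

/-- iterated numerators -/
noncomputable def PL (A B p0 : MvPolynomial (Fin n) R) (s : R) : List (Fin n) → MvPolynomial (Fin n) R
  | [] => p0
  | i :: L => nab A B i (1 + 2 * L.length) (s - 1 - L.length) (PL A B p0 s L)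

theorem td_pderiv (i : Fin n) (p : MvPolynomial (Fin n) R) : (pderiv i p).totalDegree ≤ p.totalDegree := by
  conv_lhs => rw [p.as_sum, map_sum]
  refine totalDegree_finsetSum_le fun m hm => ?_
  rw [pderiv_monomial]
  refine (totalDegree_monomial_le _ _).trans ?_
  refine le_trans ?_ (le_totalDegree hm)
  exact Finsupp.sum_le_sum_index tsub_le_self (fun _ _ => monotone_id) (fun _ _ => rfl)

theorem td_nab (A B p : MvPolynomial (Fin n) R) (i : Fin n) (r : ℕ) (τ : R) :
    (nab A B i r τ p).totalDegree ≤ p.totalDegree + (A.totalDegree + B.totalDegree) := by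
  have hp := td_pderiv i p
  have hA := td_pderiv i A
  have hB := td_pderiv i B
  unfold nab
  refine (totalDegree_add _ _).trans (max_le ?_ ?_)
  · refine (totalDegree_mul _ _).trans ?_
    have h1 := totalDegree_sub (B * pderiv i p) (C (r : R) * p * pderiv i B)
    have h2 := totalDegree_mul B (pderiv i p)
    have h3 := totalDegree_mul (C (r : R) * p) (pderiv i B)
    have h4 := totalDegree_mul (C (r : R)) p
    rw [totalDegree_C] at h4
    have h5 : max (B * pderiv i p).totalDegree (C (r : R) * p * pderiv i B).totalDegree ≤ p.totalDegree + B.totalDegree :=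
      max_le (by omega) (by omega)
    omega
  · refine (totalDegree_mul _ _).trans ?_
    have h1 := totalDegree_sub (B * pderiv i A) (A * pderiv i B)
    have h2 := totalDegree_mul B (pderiv i A)
    have h3 := totalDegree_mul A (pderiv i B)
    have h4 := totalDegree_mul (C τ) p
    rw [totalDegree_C] at h4
    have h5 : max (B * pderiv i A).totalDegree (A * pderiv i B).totalDegree ≤ A.totalDegree + B.totalDegree :=
      max_le (by omega) (by omega)
    omega

theorem td_PL (A B p0 : MvPolynomial (Fin n) R) (s : R) (L : List (Fin n)) :
    (PL A B p0 s L).totalDegree ≤ p0.totalDegree + L.length * (A.totalDegree + B.totalDegree) := by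
  induction L with
  | nil => simp [PL]
  | cons i L ih =>
    refine (td_nab ..).trans ?_
    rw [List.length_cons, add_mul]
    omega

theorem map_PL {S : Type*} [CommRing S] (φ : R →+* S) (A B p0 : MvPolynomial (Fin n) R) (s : R) (L : List (Fin n)) :
    map φ (PL A B p0 s L) = PL (map φ A) (map φ B) (map φ p0) (φ s) L := by
  induction L with
  | nil => simp [PL]
  | cons i L ih =>
    simp only [PL, nab, map_add, map_mul, map_sub, map_C, ← ih, pderiv_map, map_natCast, map_one]

/-- list attached to a multi-index -/
def LL {N : ℕ} (β : Fin n → Fin N) : List (Fin n) :=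
  (List.finRange n).flatMap (fun i => List.replicate (β i) i)

theorem count_LL {N : ℕ} (β : Fin n → Fin N) (i : Fin n) : (LL β).count i = β i := by
  unfold LL
  rw [List.count_flatMap]
  have : (List.map (List.count i ∘ fun i ↦ List.replicate (↑(β i)) i) (List.finRange n)).sum
      = ∑ j : Fin n, if j = i then (β j : ℕ) else 0 := by
    rw [← List.sum_ofFn, List.ofFn_eq_map]
    congr 1
    apply List.map_congr_left
    intro j _
    simp [List.count_replicate]
  rw [this]
  simp

theorem length_LL {N : ℕ} (β : Fin n → Fin N) : (LL β).length = ∑ i, (β i : ℕ) := by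
  unfold LL
  rw [List.length_flatMap, ← List.sum_ofFn, List.ofFn_eq_map]
  simp

theorem length_LL_le {N : ℕ} (β : Fin n → Fin N) : (LL β).length ≤ n * N := by
  rw [length_LL]
  refine (Finset.sum_le_card_nsmul _ _ N (fun i _ => (β i).2.le)).trans ?_
  simp

end alg

/-- iterated derivatives, the head of the list first -/
noncomputable def dL {n : ℕ} : List (Fin n) → MvPolynomial (Fin n) ℝ → MvPolynomial (Fin n) ℝ
  | [], p => p
  | i :: L, p => dL L (pderiv i p)

theorem dL_zero {n : ℕ} (L : List (Fin n)) : dL L 0 = 0 := by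
  induction L with
  | nil => rfl
  | cons i L ih => simp [dL, ih]

theorem dL_monomial_eq_zero {n : ℕ} (L : List (Fin n)) (γ : Fin n →₀ ℕ) (a : ℝ) (h : ∃ i, γ i < L.count i) :
    dL L (monomial γ a) = 0 := by
  induction L generalizing γ a with
  | nil => simp at h
  | cons i L ih =>
    simp only [dL, pderiv_monomial]
    obtain ⟨j, hj⟩ := h
    by_cases h0 : γ i = 0
    · simp [h0, dL_zero]
    apply ih
    refine ⟨j, ?_⟩
    rw [List.count_cons] at hj
    simp only [Finsupp.coe_tsub, Pi.sub_apply, Finsupp.single_apply]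
    by_cases hij : i = j
    · subst hij
      simp at hj ⊢
      omega
    · simp [hij] at hj ⊢
      omega

theorem dL_monomial_eq {n : ℕ} (L : List (Fin n)) (γ : Fin n →₀ ℕ) (a : ℝ) (ha : a ≠ 0) (h : ∀ i, L.count i = γ i) :
    ∃ κ : ℝ, κ ≠ 0 ∧ dL L (monomial γ a) = C κ := by
  induction L generalizing γ a with
  | nil =>
    refine ⟨a, ha, ?_⟩
    have : γ = 0 := by ext i; simp [← h i]
    subst this; rfl
  | cons i L ih =>
    simp only [dL, pderiv_monomial]
    have hi : γ i ≠ 0 := by rw [← h i]; simp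
    refine ih _ _ (mul_ne_zero ha (by exact_mod_cast hi)) ?_
    intro j
    have hj := h j
    rw [List.count_cons] at hj
    simp only [Finsupp.coe_tsub, Pi.sub_apply, Finsupp.single_apply]
    by_cases hij : i = j
    · subst hij
      simp at hj ⊢
      omega
    · simp [hij] at hj ⊢
      omega

open Polynomial in
theorem exists_relation {n : ℕ} (A B p0 : MvPolynomial (Fin n) ℝ) :
    ∃ (N : ℕ) (c : Fin N × (Fin n → Fin N) → ℝ[X]), c ≠ 0 ∧
      ∑ x, MvPolynomial.C (c x) * (PL (map Polynomial.C A) (map Polynomial.C B) (map Polynomial.C p0) 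
          (Polynomial.X + Polynomial.C ((x.1 : ℕ) : ℝ)) (LL x.2)
        * map Polynomial.C A ^ ((x.1 : ℕ) + (n * N - (LL x.2).length))
        * map Polynomial.C B ^ ((n * N - (LL x.2).length) + (N - x.1))) = 0 := by
  set D := A.totalDegree + B.totalDegree with hD
  set d0 := p0.totalDegree
  set q := d0 + (2 * n + 1) * D + 1 with hq
  set N := q ^ n + 1 with hN
  set E := d0 + (2 * n * N + N) * D with hE
  let T : Fin N × (Fin n → Fin N) → MvPolynomial (Fin n) ℝ[X] := fun x => 
    (PL (map Polynomial.C A) (map Polynomial.C B) (map Polynomial.C p0) 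
          (Polynomial.X + Polynomial.C ((x.1 : ℕ) : ℝ)) (LL x.2)
        * map Polynomial.C A ^ ((x.1 : ℕ) + (n * N - (LL x.2).length))
        * map Polynomial.C B ^ ((n * N - (LL x.2).length) + (N - x.1)))
  have tdm : ∀ p : MvPolynomial (Fin n) ℝ, (map (Polynomial.C : ℝ →+* ℝ[X]) p).totalDegree ≤ p.totalDegree :=
    fun p => Finset.sup_mono (support_map_subset _ _)
  have hT : ∀ x, (T x).totalDegree ≤ E := by
    intro x
    have hl := length_LL_le x.2
    have hx := x.1.2
    have h1 := td_PL (map Polynomial.C A) (map Polynomial.C B) (map Polynomial.C p0) 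
          (Polynomial.X + Polynomial.C ((x.1 : ℕ) : ℝ)) (LL x.2)
    have hA := tdm A
    have hB := tdm B
    have hp := tdm p0
    have h1' : (LL x.2).length * ((map (Polynomial.C : ℝ →+* ℝ[X]) A).totalDegree + (map (Polynomial.C : ℝ →+* ℝ[X]) B).totalDegree) ≤ n * N * D :=
      Nat.mul_le_mul hl (by omega)
    have h2 : (map (Polynomial.C : ℝ →+* ℝ[X]) A ^ ((x.1 : ℕ) + (n * N - (LL x.2).length))).totalDegree ≤ (n * N + N) * A.totalDegree :=
      (totalDegree_pow _ _).trans (Nat.mul_le_mul (by omega) hA)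
    have h3 : (map (Polynomial.C : ℝ →+* ℝ[X]) B ^ ((n * N - (LL x.2).length) + (N - x.1))).totalDegree ≤ (n * N + N) * B.totalDegree :=
      (totalDegree_pow _ _).trans (Nat.mul_le_mul (by omega) hB)
    have h4 : (T x).totalDegree ≤ _ := (totalDegree_mul _ _).trans (add_le_add (totalDegree_mul _ _) le_rfl)
    have h5 : E = d0 + n * N * D + ((n * N + N) * A.totalDegree + (n * N + N) * B.totalDegree) := by
      rw [hE, hD]; ring
    omega
  let Λ : (Fin N × (Fin n → Fin N) → ℝ[X]) →ₗ[ℝ[X]] ((Fin n → Fin (E + 1)) → ℝ[X]) :=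
    LinearMap.pi fun e => 
      (MvPolynomial.lcoeff ℝ[X] (Finsupp.equivFunOnFinite.symm (fun i => (e i : ℕ)))) ∘ₗ 
        (Fintype.linearCombination ℝ[X] T)
  have hcard : ¬ Function.Injective Λ := by
    intro hinj
    have h := card_le_of_injective ℝ[X] Λ hinj
    simp only [Fintype.card_prod, Fintype.card_fin, Fintype.card_pi, Finset.prod_const, Finset.card_univ] at h
    have h1 : E + 1 ≤ q * N := by
      rw [hE, hq]
      have : 1 ≤ N := by omega
      nlinarith [Nat.zero_le d0]
    have h2 : (E + 1) ^ n ≤ q ^ n * N ^ n := by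
      rw [← mul_pow]; exact Nat.pow_le_pow_left h1 n
    have h3 : 0 < N ^ n := by positivity
    have h4 : q ^ n * N ^ n < N * N ^ n := Nat.mul_lt_mul_of_pos_right (by omega) h3
    omega
  rw [← LinearMap.ker_eq_bot, Submodule.eq_bot_iff] at hcard
  push Not at hcard
  obtain ⟨c, hc, hc0⟩ := hcard
  refine ⟨N, c, hc0, ?_⟩
  change ∑ x, MvPolynomial.C (c x) * T x = 0
  have hsum : ∑ x, MvPolynomial.C (c x) * T x = Fintype.linearCombination ℝ[X] T c := by
    rw [Fintype.linearCombination_apply]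
    simp [MvPolynomial.smul_eq_C_mul]
  rw [hsum]
  ext1 m
  rw [MvPolynomial.coeff_zero]
  by_cases hm : ∀ i, m i < E + 1
  · have := congrFun (LinearMap.mem_ker.1 hc) (fun i => ⟨m i, hm i⟩)
    simp only [Λ, LinearMap.pi_apply, LinearMap.comp_apply, MvPolynomial.lcoeff_apply, Pi.zero_apply] at this
    convert this using 2
    ext i; simp
  · push Not at hm
    obtain ⟨i, hi⟩ := hm
    rw [← hsum]
    apply MvPolynomial.coeff_eq_zero_of_totalDegree_lt
    have h1 : (∑ x, MvPolynomial.C (c x) * T x).totalDegree ≤ E := by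
      refine totalDegree_finsetSum_le fun x _ => ?_
      refine (totalDegree_mul _ _).trans ?_
      rw [totalDegree_C, zero_add]
      exact hT x
    have h2 : m i ≤ ∑ i ∈ m.support, m i := by
      by_cases h : m i = 0
      · omega
      · exact Finset.single_le_sum (fun _ _ => Nat.zero_le _) (Finsupp.mem_support_iff.2 h)
    omega

end PeriodAux


namespace PeriodAux
open MvPolynomial MeasureTheory Set Filter Topology

structure Dat {n : ℕ} (U : Set (Fin n → ℝ)) (A B : MvPolynomial (Fin n) ℝ) : Prop where
  isOpen : IsOpen U
  pos : ∀ x ∈ U, 0 < eval x A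
  bdry : ∀ x ∈ closure U, x ∉ U → eval x A = 0
  one_le : ∀ x, 1 ≤ eval x B
  dom : ∀ x, eval x A * (1 + ‖x‖ ^ 2) ≤ eval x B

/-- basic functions -/
noncomputable def psi {n : ℕ} (U : Set (Fin n → ℝ)) (A B p : MvPolynomial (Fin n) ℝ) (r : ℕ) (τ : ℝ) (x : Fin n → ℝ) : ℝ :=
  U.indicator (fun x => eval x p * (eval x B ^ r)⁻¹ * (eval x A / eval x B) ^ τ) x

theorem eval_bound {n : ℕ} (p : MvPolynomial (Fin n) ℝ) (d : ℕ) (hd : p.totalDegree ≤ d) :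
    ∃ K : ℝ, 0 ≤ K ∧ ∀ x : Fin n → ℝ, |eval x p| ≤ K * (1 + ‖x‖ ^ 2) ^ d := by
  refine ⟨∑ m ∈ p.support, |coeff m p|, Finset.sum_nonneg fun _ _ => abs_nonneg _, fun x => ?_⟩
  rw [eval_eq, Finset.sum_mul]
  refine (Finset.abs_sum_le_sum_abs _ _).trans (Finset.sum_le_sum fun m hm => ?_)
  rw [abs_mul]
  refine mul_le_mul_of_nonneg_left ?_ (abs_nonneg _)
  rw [Finset.abs_prod]
  have h1 : (1 : ℝ) ≤ 1 + ‖x‖ ^ 2 := by nlinarith [sq_nonneg ‖x‖]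
  calc ∏ i ∈ m.support, |x i ^ m i| ≤ ∏ i ∈ m.support, (1 + ‖x‖ ^ 2) ^ m i := by
        refine Finset.prod_le_prod (fun _ _ => abs_nonneg _) fun i _ => ?_
        rw [abs_pow]
        refine pow_le_pow_left₀ (abs_nonneg _) ?_ _
        have := norm_le_pi_norm x i
        rw [Real.norm_eq_abs] at this
        nlinarith [sq_nonneg (‖x‖ - 1), norm_nonneg x]
    _ = (1 + ‖x‖ ^ 2) ^ (∑ i ∈ m.support, m i) := by rw [Finset.prod_pow_eq_pow_sum]
    _ ≤ _ := pow_le_pow_right₀ h1 ((le_totalDegree hm).trans hd)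

section
variable {n : ℕ} {U : Set (Fin n → ℝ)} {A B : MvPolynomial (Fin n) ℝ}

theorem Dat.phi_le (h : Dat U A B) (x : Fin n → ℝ) : eval x A / eval x B ≤ (1 + ‖x‖ ^ 2)⁻¹ := by
  have h1 := h.one_le x
  have h2 := h.dom x
  have h3 : (0 : ℝ) < 1 + ‖x‖ ^ 2 := by positivity
  rw [div_le_iff₀ (by linarith), inv_mul_eq_div, le_div_iff₀ h3]
  exact h2

theorem Dat.phi_pos (h : Dat U A B) {x : Fin n → ℝ} (hx : x ∈ U) : 0 < eval x A / eval x B :=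
  div_pos (h.pos x hx) (by linarith [h.one_le x])

theorem psi_bound (h : Dat U A B) (p : MvPolynomial (Fin n) ℝ) (d : ℕ) (hd : p.totalDegree ≤ d) :
    ∃ K : ℝ, 0 ≤ K ∧ ∀ (r : ℕ) (τ : ℝ), 0 ≤ τ → ∀ x : Fin n → ℝ, |psi U A B p r τ x| ≤ K * (1 + ‖x‖ ^ 2) ^ ((d : ℝ) - τ) := by
  obtain ⟨K, hK0, hK⟩ := eval_bound p d hd
  refine ⟨K, hK0, fun r τ hτ x => ?_⟩
  have h3 : (0 : ℝ) < 1 + ‖x‖ ^ 2 := by positivity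
  unfold psi
  by_cases hx : x ∈ U
  · rw [indicator_of_mem hx, abs_mul, abs_mul]
    have hB := h.one_le x
    have h1 : |(eval x B ^ r)⁻¹| ≤ 1 := by
      rw [abs_of_nonneg (by positivity)]
      exact inv_le_one_of_one_le₀ (one_le_pow₀ hB)
    have h2 : |(eval x A / eval x B) ^ τ| ≤ (1 + ‖x‖ ^ 2) ^ (-τ) := by
      rw [abs_of_nonneg (Real.rpow_nonneg (h.phi_pos hx).le _), Real.rpow_neg h3.le, ← Real.inv_rpow h3.le]
      exact Real.rpow_le_rpow (h.phi_pos hx).le (h.phi_le x) hτ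
    rw [sub_eq_add_neg, Real.rpow_add h3, ← mul_assoc, Real.rpow_natCast]
    refine mul_le_mul ?_ h2 (abs_nonneg _) (by positivity)
    calc _ ≤ (K * (1 + ‖x‖ ^ 2) ^ d) * 1 := mul_le_mul (hK x) h1 (abs_nonneg _) (by positivity)
      _ = _ := mul_one _
  · rw [indicator_of_notMem hx]
    simp
    positivity

theorem psi_measurable (h : Dat U A B) (p : MvPolynomial (Fin n) ℝ) (r : ℕ) (τ : ℝ) : Measurable (psi U A B p r τ) := by
  have hc : ∀ p : MvPolynomial (Fin n) ℝ, Measurable (fun x : Fin n → ℝ => eval x p) := fun p =>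
    (MvPolynomial.continuous_eval p).measurable
  refine Measurable.indicator ?_ h.isOpen.measurableSet
  exact ((hc p).mul ((hc B).pow_const r).inv).mul (((hc A).div (hc B)).pow_const τ)

theorem psi_integrable (h : Dat U A B) (p : MvPolynomial (Fin n) ℝ) (d : ℕ) (hd : p.totalDegree ≤ d) (r : ℕ) (τ : ℝ)
    (hτ : (d : ℝ) + n + 1 ≤ τ) : Integrable (psi U A B p r τ) := by
  obtain ⟨K, hK0, hK⟩ := psi_bound h p d hd
  have h1 : Integrable (fun x : Fin n → ℝ => ((1 : ℝ) + ‖x‖ ^ 2) ^ (-(2 * (τ - d)) / 2)) := by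
    apply integrable_rpow_neg_one_add_norm_sq
    simp
    linarith [Nat.cast_nonneg (α := ℝ) n]
  have hd0 := Nat.cast_nonneg (α := ℝ) d
  have hn0 := Nat.cast_nonneg (α := ℝ) n
  refine (h1.const_mul K).mono' (psi_measurable h p r τ).aestronglyMeasurable (Eventually.of_forall fun x => ?_)
  rw [Real.norm_eq_abs]
  convert hK r τ (by linarith) x using 3
  ring

theorem eval_hasDeriv (p : MvPolynomial (Fin n) ℝ) (i : Fin n) (x : Fin n → ℝ) (t : ℝ) :
    HasDerivAt (fun t : ℝ => eval (x + t • Pi.single i (1 : ℝ)) p) (eval (x + t • Pi.single i (1:ℝ)) (pderiv i p)) t := by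
  induction p using MvPolynomial.induction_on with
  | C a => simpa using hasDerivAt_const t a
  | add p q hp hq =>
    simp only [map_add]
    exact hp.add hq
  | mul_X p j hp =>
    have hX : HasDerivAt (fun t : ℝ => eval (x + t • Pi.single i (1 : ℝ)) (X j)) ((Pi.single i (1:ℝ) : Fin n → ℝ) j) t := by
      simp only [eval_X, Pi.add_apply, Pi.smul_apply, smul_eq_mul]
      simpa using ((hasDerivAt_id t).mul_const ((Pi.single i (1:ℝ) : Fin n → ℝ) j)).const_add (x j)
    have := hp.mul hX
    rw [Derivation.leibniz, pderiv_X]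
    simp only [map_mul, map_add, smul_eq_mul] at *
    refine this.congr_deriv ?_
    by_cases hij : i = j
    · subst hij; simp; ring
    · simp [Pi.single_apply, hij, Ne.symm hij]; ring

theorem psi_hasLineDerivAt (h : Dat U A B) (p : MvPolynomial (Fin n) ℝ) (r : ℕ) (τ : ℝ) (hτ : 1 < τ) (i : Fin n) (x : Fin n → ℝ) :
    HasLineDerivAt ℝ (psi U A B p r τ) (psi U A B (nab A B i r τ p) (r + 2) (τ - 1) x) x (Pi.single i 1) := by
  unfold HasLineDerivAt
  have hp := eval_hasDeriv p i x 0
  have hA := eval_hasDeriv A i x 0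
  have hB := eval_hasDeriv B i x 0
  set x' : ℝ → (Fin n → ℝ) := fun t => x + t • Pi.single i (1 : ℝ) with hx'
  have hx0 : x' 0 = x := by simp [hx']
  have hB0 : eval x B ≠ 0 := by linarith [h.one_le x]
  have hcont : Continuous x' := by fun_prop
  have hk : HasDerivAt (fun t => eval (x' t) p * (eval (x' t) B ^ r)⁻¹ * (eval (x' t) A / eval (x' t) B) ^ τ) 
    (eval x (nab A B i r τ p) * (eval x B ^ (r+2))⁻¹ * (eval x A / eval x B) ^ (τ - 1)) 0 := by
    have hBr := (hB.pow r).inv (by simp only [Pi.pow_apply]; simp [hB0])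
    have hAB := (hA.div hB (by simp [hB0])).rpow_const (p := τ) (Or.inr hτ.le)
    refine ((hp.mul hBr).mul hAB).congr_deriv ?_
    simp only [Pi.mul_apply, Pi.inv_apply, Pi.pow_apply, Pi.div_apply]
    simp only [zero_smul, add_zero]
    have e : (eval x A / eval x B) ^ τ = (eval x A / eval x B) ^ (τ - 1) * (eval x A / eval x B) := by
      by_cases hz : eval x A / eval x B = 0
      · rw [hz, Real.zero_rpow (by linarith)]; simp
      · rw [Real.rpow_sub_one hz, div_mul_cancel₀ _ hz]
    rw [e]
    generalize (eval x A / eval x B) ^ (τ - 1) = Y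
    simp only [nab, map_add, map_mul, map_sub, eval_C]
    rcases r with _ | r
    · simp
      field_simp
    · simp only [Nat.add_sub_cancel]
      field_simp
      ring
  by_cases hxU : x ∈ U
  · have hval : psi U A B (nab A B i r τ p) (r + 2) (τ - 1) x = eval x (nab A B i r τ p) * (eval x B ^ (r+2))⁻¹ * (eval x A / eval x B) ^ (τ - 1) := by
      unfold psi; rw [indicator_of_mem hxU]
    rw [hval]
    refine hk.congr_of_eventuallyEq ?_
    have : ∀ᶠ t in 𝓝 (0:ℝ), x' t ∈ U := by
      apply hcont.continuousAt.eventually_mem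
      rw [hx0]; exact h.isOpen.mem_nhds hxU
    filter_upwards [this] with t ht
    unfold psi; rw [indicator_of_mem ht]
  · have hval : psi U A B (nab A B i r τ p) (r + 2) (τ - 1) x = 0 := by
      unfold psi; rw [indicator_of_notMem hxU]
    rw [hval]
    by_cases hcl : x ∈ closure U
    · have hA0 := h.bdry x hcl hxU
      have hk0 : eval x (nab A B i r τ p) * (eval x B ^ (r+2))⁻¹ * (eval x A / eval x B) ^ (τ - 1) = 0 := by
        rw [hA0, zero_div, Real.zero_rpow (by linarith), mul_zero]
      rw [hk0] at hk
      rw [hasDerivAt_iff_isLittleO] at hk ⊢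
      refine Asymptotics.IsBigO.trans_isLittleO (Asymptotics.IsBigO.of_bound 1 (Eventually.of_forall fun t => ?_)) hk
      have e0 : psi U A B p r τ x = 0 := by
        unfold psi; rw [indicator_of_notMem hxU]
      have e1 : (eval x A / eval x B) ^ τ = 0 := by
        rw [hA0, zero_div, Real.zero_rpow (by linarith)]
      simp only [zero_smul, add_zero, e0, hx0, e1, mul_zero, sub_zero, smul_zero, one_mul]
      unfold psi
      by_cases ht : x' t ∈ U
      · rw [indicator_of_mem ht]
      · rw [indicator_of_notMem ht, norm_zero]; exact norm_nonneg _
    · refine (hasDerivAt_const (0:ℝ) (0:ℝ)).congr_of_eventuallyEq ?_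
      have : ∀ᶠ t in 𝓝 (0:ℝ), x' t ∈ (closure U)ᶜ := by
        apply hcont.continuousAt.eventually_mem
        rw [hx0]; exact isClosed_closure.isOpen_compl.mem_nhds hcl
      filter_upwards [this] with t ht
      unfold psi; rw [indicator_of_notMem (fun h => ht (subset_closure h))]

end

end PeriodAux


namespace PeriodAux
open MvPolynomial MeasureTheory Set Filter Topology

section
variable {n : ℕ} {U : Set (Fin n → ℝ)} {A B : MvPolynomial (Fin n) ℝ}

theorem lip_of_line {F : (Fin n → ℝ) → ℝ} {F' : Fin n → (Fin n → ℝ) → ℝ} {C : ℝ}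
    (hF : ∀ i x, HasLineDerivAt ℝ F (F' i x) x (Pi.single i 1)) (hC : ∀ i x, |F' i x| ≤ C) (x y : Fin n → ℝ) :
    |F y - F x| ≤ n * C * ‖y - x‖ := by
  have h1 : ∀ i x t, |F (x + t • Pi.single i (1 : ℝ)) - F x| ≤ C * |t| := by
    intro i x t
    have := Convex.norm_image_sub_le_of_norm_hasDerivWithin_le (f := fun t : ℝ => F (x + t • Pi.single i (1 : ℝ)))
      (f' := fun t => F' i (x + t • Pi.single i (1:ℝ))) (s := univ) (x := 0) (y := t) (C := C) ?_ ?_ convex_univ (mem_univ _) (mem_univ _)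
    · simpa using this
    · intro u _
      refine HasDerivAt.hasDerivWithinAt ?_
      have h2 := hF i (x + u • Pi.single i (1:ℝ))
      unfold HasLineDerivAt at h2
      have h3 : HasDerivAt (fun v : ℝ => v - u) 1 u := by simpa using (hasDerivAt_id u).sub_const u
      have h4 := HasDerivAt.scomp u (g₁ := fun t : ℝ => F (x + u • Pi.single i (1:ℝ) + t • Pi.single i (1:ℝ))) (h := fun v : ℝ => v - u) (by simpa using h2) h3
      simp only [one_smul] at h4
      refine h4.congr_of_eventuallyEq (Eventually.of_forall fun v => ?_)
      simp only [Function.comp]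
      congr 1
      module
    · intro u _; exact hC _ _
  have h2 : ∀ s : Finset (Fin n), |F (x + ∑ i ∈ s, (y i - x i) • Pi.single i (1:ℝ)) - F x| ≤ ∑ i ∈ s, C * |y i - x i| := by
    intro s
    induction s using Finset.induction_on with
    | empty => simp
    | insert a s ha ih =>
      rw [Finset.sum_insert ha, Finset.sum_insert ha]
      have := h1 a (x + ∑ i ∈ s, (y i - x i) • Pi.single i (1:ℝ)) (y a - x a)
      rw [add_comm ((y a - x a) • _), ← add_assoc]
      calc _ = |(F (x + ∑ i ∈ s, (y i - x i) • Pi.single i (1:ℝ) + (y a - x a) • Pi.single a 1) - F (x + ∑ i ∈ s, (y i - x i) • Pi.single i (1:ℝ))) + (F (x + ∑ i ∈ s, (y i - x i) • Pi.single i (1:ℝ)) - F x)| := by ring_nf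
        _ ≤ _ := (abs_add_le _ _).trans (add_le_add this ih)
  have h3 := h2 Finset.univ
  have h4 : x + ∑ i, (y i - x i) • Pi.single i (1:ℝ) = y := by
    ext j
    simp [Finset.sum_apply, Pi.single_apply]
  rw [h4] at h3
  refine h3.trans ?_
  have : ∀ i ∈ (Finset.univ : Finset (Fin n)), C * |y i - x i| ≤ C * ‖y - x‖ := by
    intro i _
    have hC0 : 0 ≤ C := (abs_nonneg _).trans (hC i x)
    exact mul_le_mul_of_nonneg_left (norm_le_pi_norm (y - x) i) hC0
  refine (Finset.sum_le_card_nsmul _ _ _ this).trans ?_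
  simp [mul_assoc]

theorem psi_bdd (h : Dat U A B) (p : MvPolynomial (Fin n) ℝ) (r : ℕ) (τ : ℝ) (hτ : (p.totalDegree : ℝ) ≤ τ) :
    ∃ K : ℝ, ∀ x, |psi U A B p r τ x| ≤ K := by
  obtain ⟨K, hK0, hK⟩ := psi_bound h p _ le_rfl
  refine ⟨K, fun x => ?_⟩
  have hd0 := Nat.cast_nonneg (α := ℝ) p.totalDegree
  refine (hK r τ (hd0.trans hτ) x).trans ?_
  have h3 : (1 : ℝ) ≤ 1 + ‖x‖ ^ 2 := by nlinarith [sq_nonneg ‖x‖]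
  have := Real.rpow_le_one_of_one_le_of_nonpos h3 (sub_nonpos.2 hτ)
  nlinarith

theorem psi_lip (h : Dat U A B) (p : MvPolynomial (Fin n) ℝ) (r : ℕ) (τ : ℝ)
    (hτ : (p.totalDegree : ℝ) + A.totalDegree + B.totalDegree + 2 ≤ τ) :
    ∃ K : ℝ, ∀ x y, |psi U A B p r τ y - psi U A B p r τ x| ≤ K * ‖y - x‖ := by
  have h0 : ∀ i : Fin n, ∃ K : ℝ, ∀ x, |psi U A B (nab A B i r τ p) (r + 2) (τ - 1) x| ≤ K := by
    intro i
    apply psi_bdd h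
    have := td_nab A B p i r τ
    have h2 : ((nab A B i r τ p).totalDegree : ℝ) ≤ p.totalDegree + (A.totalDegree + B.totalDegree) := by exact_mod_cast this
    linarith
  choose K hK using h0
  refine ⟨n * ∑ i, |K i|, fun x y => ?_⟩
  refine lip_of_line (F' := fun i x => psi U A B (nab A B i r τ p) (r + 2) (τ - 1) x) (fun i x => psi_hasLineDerivAt h p r τ ?_ i x) (fun i x => ?_) x y
  · have h1 := Nat.cast_nonneg (α := ℝ) p.totalDegree
    have h2 := Nat.cast_nonneg (α := ℝ) A.totalDegree
    have h3 := Nat.cast_nonneg (α := ℝ) B.totalDegree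
    linarith
  · exact (hK i x).trans ((le_abs_self _).trans (Finset.single_le_sum (f := fun i => |K i|) (fun _ _ => abs_nonneg _) (Finset.mem_univ i)))

theorem psi_mul (φ p : MvPolynomial (Fin n) ℝ) (r : ℕ) (τ : ℝ) (x : Fin n → ℝ) :
    psi U A B (φ * p) r τ x = eval x φ * psi U A B p r τ x := by
  unfold psi
  by_cases hx : x ∈ U
  · simp only [indicator_of_mem hx, map_mul]; ring
  · simp only [indicator_of_notMem hx, mul_zero]

theorem psi_ibp (h : Dat U A B) (φ p : MvPolynomial (Fin n) ℝ) (r : ℕ) (τ : ℝ) (i : Fin n)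
    (hτ : (φ.totalDegree : ℝ) + p.totalDegree + A.totalDegree + B.totalDegree + n + 2 ≤ τ) :
    ∫ x, psi U A B (φ * nab A B i r τ p) (r + 2) (τ - 1) x = - ∫ x, psi U A B (pderiv i φ * p) r τ x := by
  have h0 := Nat.cast_nonneg (α := ℝ) φ.totalDegree
  have h1 := Nat.cast_nonneg (α := ℝ) p.totalDegree
  have h2 := Nat.cast_nonneg (α := ℝ) A.totalDegree
  have h3 := Nat.cast_nonneg (α := ℝ) B.totalDegree
  have h4 := Nat.cast_nonneg (α := ℝ) n
  have := integral_bilinear_hasLineDerivAt_right_eq_neg_left_of_integrable (μ := (volume : Measure (Fin n → ℝ)))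
    (f := fun x => eval x φ) (f' := fun x => eval x (pderiv i φ)) (g := psi U A B p r τ)
    (g' := psi U A B (nab A B i r τ p) (r + 2) (τ - 1)) (v := Pi.single i 1) (B := ContinuousLinearMap.mul ℝ ℝ)
    ?_ ?_ ?_ ?_ ?_
  · simp only [ContinuousLinearMap.mul_apply', ← psi_mul] at this
    exact this
  · simp only [ContinuousLinearMap.mul_apply', ← psi_mul]
    refine psi_integrable h _ (φ.totalDegree + p.totalDegree) ((totalDegree_mul _ _).trans (add_le_add (td_pderiv _ _) le_rfl)) _ _ ?_
    push_cast; linarith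
  · simp only [ContinuousLinearMap.mul_apply', ← psi_mul]
    refine psi_integrable h _ (φ.totalDegree + (p.totalDegree + (A.totalDegree + B.totalDegree))) ((totalDegree_mul _ _).trans (add_le_add le_rfl (td_nab _ _ _ _ _ _))) _ _ ?_
    push_cast; linarith
  · simp only [ContinuousLinearMap.mul_apply', ← psi_mul]
    refine psi_integrable h _ (φ.totalDegree + p.totalDegree) (totalDegree_mul _ _) _ _ ?_
    push_cast; linarith
  · intro x _
    have := eval_hasDeriv φ i x 0
    unfold HasLineDerivAt
    simpa using this
  · intro x _
    exact psi_hasLineDerivAt h p r τ (by linarith) i x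

theorem psi_ibp_list (h : Dat U A B) (p0 : MvPolynomial (Fin n) ℝ) (s : ℝ) (L : List (Fin n)) (φ : MvPolynomial (Fin n) ℝ)
    (hs : (φ.totalDegree : ℝ) + p0.totalDegree + L.length * (A.totalDegree + B.totalDegree) + n + 4 + L.length ≤ s) :
    ∫ x, psi U A B (φ * PL A B p0 s L) (1 + 2 * L.length) (s - 1 - L.length) x =
      (-1) ^ L.length * ∫ x, psi U A B (dL L φ * p0) 1 (s - 1) x := by
  induction L generalizing φ with
  | nil => simp [PL, dL]
  | cons i L ih =>
    have h2 := Nat.cast_nonneg (α := ℝ) A.totalDegree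
    have h3 := Nat.cast_nonneg (α := ℝ) B.totalDegree
    have h4 := Nat.cast_nonneg (α := ℝ) L.length
    have hq : ((PL A B p0 s L).totalDegree : ℝ) ≤ p0.totalDegree + L.length * (A.totalDegree + B.totalDegree) := by
      exact_mod_cast td_PL A B p0 s L
    simp only [List.length_cons] at hs
    push_cast at hs
    have e := psi_ibp h φ (PL A B p0 s L) (1 + 2 * L.length) (s - 1 - L.length) i (by nlinarith)
    have hφ : (((pderiv i φ).totalDegree : ℝ)) ≤ φ.totalDegree := by exact_mod_cast td_pderiv i φ
    have e2 := ih (pderiv i φ) (by nlinarith)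
    rw [e2] at e
    simp only [List.length_cons, PL, dL]
    push_cast
    rw [show 1 + 2 * (L.length + 1) = 1 + 2 * L.length + 2 by ring, show s - 1 - ((L.length : ℝ) + 1) = s - 1 - L.length - 1 by ring, e, pow_succ]
    ring

end
end PeriodAux


namespace PeriodAux
open MvPolynomial MeasureTheory Set Filter Topology

section
variable {n : ℕ} {U : Set (Fin n → ℝ)} {A B : MvPolynomial (Fin n) ℝ}

theorem pow_identity {a b σ : ℝ} (ha : 0 < a) (hb : 0 < b) (q : ℝ) (j l K N : ℕ) (hj : j ≤ N) (hl : l ≤ K) :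
    q * (b ^ (1 + 2 * l))⁻¹ * (a / b) ^ (σ + j - 1 - l) =
      (q * a ^ (j + (K - l)) * b ^ ((K - l) + (N - j))) * ((a / b) ^ (σ - 1 - K) * (b ^ (1 + 2 * K + N))⁻¹) := by
  obtain ⟨u, rfl⟩ := Nat.exists_eq_add_of_le hl
  obtain ⟨v, rfl⟩ := Nat.exists_eq_add_of_le hj
  simp only [Nat.add_sub_cancel_left]
  have e : σ + j - 1 - l = (σ - 1 - ((l + u : ℕ) : ℝ)) + ((j + u : ℕ) : ℝ) := by push_cast; ring
  rw [e, Real.rpow_add (div_pos ha hb), Real.rpow_natCast, div_pow]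
  generalize (a / b) ^ (σ - 1 - ((l + u : ℕ) : ℝ)) = Y
  field_simp
  ring

theorem psi_relation (h : Dat U A B) (p0 : MvPolynomial (Fin n) ℝ) (N : ℕ) (c : Fin N × (Fin n → Fin N) → Polynomial ℝ)
    (hrel : ∑ x : Fin N × (Fin n → Fin N), MvPolynomial.C (c x) * (PL (map Polynomial.C A) (map Polynomial.C B) (map Polynomial.C p0)
      (Polynomial.X + Polynomial.C ((x.1 : ℕ) : ℝ)) (LL x.2) * (map Polynomial.C A)^((x.1 : ℕ) + (n*N - (LL x.2).length)) *
        (map Polynomial.C B)^((n*N - (LL x.2).length) + (N - (x.1 : ℕ)))) = 0) (σ : ℝ) (x : Fin n → ℝ) :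
    ∑ y : Fin N × (Fin n → Fin N), (c y).eval σ * psi U A B (PL A B p0 (σ + (y.1 : ℕ)) (LL y.2)) (1 + 2 * (LL y.2).length)
      (σ + (y.1 : ℕ) - 1 - (LL y.2).length) x = 0 := by
  by_cases hx : x ∈ U
  swap
  · refine Finset.sum_eq_zero fun y _ => ?_
    unfold psi; rw [indicator_of_notMem hx, mul_zero]
  have ha := h.pos x hx
  have hb : 0 < eval x B := by linarith [h.one_le x]
  have h1 := congrArg (fun P => eval x (map (Polynomial.evalRingHom σ) P)) hrel
  simp only [map_sum, map_mul, map_pow, map_C, map_PL, MvPolynomial.map_map, map_zero, eval_C, map_add] at h1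
  have e1 : (Polynomial.evalRingHom σ).comp Polynomial.C = RingHom.id ℝ := by ext; simp
  simp only [e1, MvPolynomial.map_id, Polynomial.coe_evalRingHom, Polynomial.eval_X, Polynomial.eval_C] at h1
  have h2 := congrArg (fun t => t * ((eval x A / eval x B) ^ (σ - 1 - ((n * N : ℕ) : ℝ)) * (eval x B ^ (1 + 2 * (n * N) + N))⁻¹)) h1
  simp only [zero_mul, Finset.sum_mul] at h2
  rw [← h2]
  refine Finset.sum_congr rfl fun y _ => ?_
  unfold psi
  rw [indicator_of_mem hx, mul_assoc (Polynomial.eval _ _)]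
  congr 1
  exact pow_identity ha hb _ _ _ _ _ y.1.2.le (length_LL_le _)

theorem recurrence (h : Dat U A B) (p0 : MvPolynomial (Fin n) ℝ) :
    ∃ (N : ℕ) (c : Fin N → Polynomial ℝ) (σ0 : ℝ), c ≠ 0 ∧ ∀ σ ≥ σ0,
      ∑ j : Fin N, (c j).eval σ * ∫ x, psi U A B p0 1 (σ + (j : ℕ) - 1) x = 0 := by
  obtain ⟨N, c, hc, hrel⟩ := exists_relation A B p0
  obtain ⟨x0, hx0⟩ := Function.ne_iff.1 hc
  classical
  obtain ⟨y0, hy0, hmin⟩ := Finset.exists_min_image (Finset.univ.filter fun y => c y ≠ 0) (fun y => (LL y.2).length)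
    ⟨x0, by simpa using hx0⟩
  simp only [Finset.mem_filter, Finset.mem_univ, true_and] at hy0 hmin
  set β0 := y0.2 with hβ0
  let γ : Fin n →₀ ℕ := Finsupp.equivFunOnFinite.symm (fun i => (β0 i : ℕ))
  have hγ : ∀ i, γ i = (β0 i : ℕ) := fun i => rfl
  set φ : MvPolynomial (Fin n) ℝ := monomial γ 1 with hφ
  obtain ⟨κ, hκ, hdL⟩ := dL_monomial_eq (LL β0) γ 1 one_ne_zero (fun i => by rw [count_LL, hγ])
  have hz : ∀ y, c y ≠ 0 → y.2 ≠ β0 → dL (LL y.2) φ = 0 := by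
    intro y hy hne
    refine dL_monomial_eq_zero _ _ _ ?_
    by_contra! hcon
    simp only [count_LL, hγ] at hcon
    have hl := hmin y hy
    rw [length_LL, length_LL] at hl
    apply hne
    have := (Finset.sum_eq_sum_iff_of_le (fun i _ => hcon i)).1 (le_antisymm (Finset.sum_le_sum fun i _ => hcon i) hl)
    ext i
    exact this i (Finset.mem_univ i)
  refine ⟨N, fun j => c (j, β0), (φ.totalDegree : ℝ) + p0.totalDegree + ((n * N : ℕ) : ℝ) * (A.totalDegree + B.totalDegree) + n + 4 + ((n * N : ℕ) : ℝ), ?_, ?_⟩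
  · intro h0
    exact hy0 (congrFun h0 y0.1)
  intro σ hσ
  have h2 := Nat.cast_nonneg (α := ℝ) A.totalDegree
  have h3 := Nat.cast_nonneg (α := ℝ) B.totalDegree
  have hb : ∀ y : Fin N × (Fin n → Fin N), (φ.totalDegree : ℝ) + p0.totalDegree + (LL y.2).length * (A.totalDegree + B.totalDegree) + n + 4 + (LL y.2).length ≤ σ + (y.1 : ℕ) := by
    intro y
    have hl : ((LL y.2).length : ℝ) ≤ ((n * N : ℕ) : ℝ) := by exact_mod_cast length_LL_le y.2
    have := mul_le_mul_of_nonneg_right hl (add_nonneg h2 h3)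
    have := Nat.cast_nonneg (α := ℝ) (y.1 : ℕ)
    linarith
  have key : ∑ y : Fin N × (Fin n → Fin N), (c y).eval σ * ∫ x, psi U A B (φ * PL A B p0 (σ + (y.1 : ℕ)) (LL y.2)) (1 + 2 * (LL y.2).length)
      (σ + (y.1 : ℕ) - 1 - (LL y.2).length) x = 0 := by
    have : ∀ x, ∑ y : Fin N × (Fin n → Fin N), (c y).eval σ * psi U A B (φ * PL A B p0 (σ + (y.1 : ℕ)) (LL y.2)) (1 + 2 * (LL y.2).length)
      (σ + (y.1 : ℕ) - 1 - (LL y.2).length) x = 0 := by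
      intro x
      have := congrArg (fun t => eval x φ * t) (psi_relation h p0 N c hrel σ x)
      simp only [mul_zero, Finset.mul_sum] at this
      rw [← this]
      refine Finset.sum_congr rfl fun y _ => ?_
      rw [psi_mul]; ring
    have h5 := integral_congr_ae (μ := (volume : Measure (Fin n → ℝ))) (Eventually.of_forall this)
    rw [integral_finsetSum] at h5
    · simpa [integral_const_mul] using h5
    · intro y _
      refine Integrable.const_mul ?_ _
      refine psi_integrable h _ (φ.totalDegree + (p0.totalDegree + (LL y.2).length * (A.totalDegree + B.totalDegree)))
        ((totalDegree_mul _ _).trans (add_le_add le_rfl (td_PL _ _ _ _ _))) _ _ ?_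
      have := hb y
      push_cast
      linarith
  have key2 : ∀ y : Fin N × (Fin n → Fin N), (c y).eval σ * ∫ x, psi U A B (φ * PL A B p0 (σ + (y.1 : ℕ)) (LL y.2)) (1 + 2 * (LL y.2).length)
      (σ + (y.1 : ℕ) - 1 - (LL y.2).length) x = if y.2 = β0 then ((-1) ^ (LL β0).length * κ) * ((c (y.1, β0)).eval σ * ∫ x, psi U A B p0 1 (σ + (y.1 : ℕ) - 1) x) else 0 := by
    intro y
    rw [psi_ibp_list h p0 _ _ φ (hb y)]
    split_ifs with hy
    · obtain ⟨j, β⟩ := y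
      simp only at hy
      subst hy
      simp only [hdL, hφ, psi_mul, eval_C, integral_const_mul]
      ring
    · by_cases hcy : c y = 0
      · simp [hcy]
      · rw [hz y hcy hy]
        have : ∀ x, psi U A B (0 * p0) 1 (σ + (y.1 : ℕ) - 1) x = 0 := fun x => by rw [psi_mul, map_zero, zero_mul]
        simp only [this, integral_zero, mul_zero]
  simp only [key2] at key
  rw [Fintype.sum_prod_type] at key
  simp only [Finset.sum_ite_eq', Finset.mem_univ, if_true, ← Finset.mul_sum] at key
  rcases mul_eq_zero.1 key with h0 | h0
  · exact absurd h0 (mul_ne_zero (pow_ne_zero _ (by norm_num)) hκ)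
  · exact h0

end
end PeriodAux


namespace PeriodAux
open MeasureTheory Set Filter Topology ProbabilityTheory

theorem an_core (Z : ℝ → ℝ) (hZ : AnalyticOnNhd ℝ Z (Ioi 0)) (d : ℕ → Polynomial ℝ) (hd : d 0 ≠ 0) (N : ℕ) (σ1 : ℝ)
    (hrec : ∀ s ≥ σ1, ∑ i ∈ Finset.range (N + 1), (d i).eval s * Z (s + i) = 0) (z0 : ℝ)
    (hlim : Tendsto Z (𝓝[>] 0) (𝓝 z0)) : ∃ K : ℝ, ∀ᶠ s in 𝓝[>] (0 : ℝ), |Z s - z0| ≤ K * s := by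
  have hpoly : ∀ (p : Polynomial ℝ) (s : ℝ), AnalyticAt ℝ (fun s => p.eval s) s := by
    intro p s
    have := (analyticAt_id (𝕜 := ℝ) (z := s)).aeval_polynomial p
    simpa using this
  have hshift : ∀ (i : ℕ) (s : ℝ), 0 < s + i → AnalyticAt ℝ (fun s => Z (s + i)) s := by
    intro i s hs
    exact AnalyticAt.fun_comp (g := Z) (f := fun s : ℝ => s + i) (hZ _ hs) (analyticAt_id.add analyticAt_const)
  have hall : ∀ s > 0, ∑ i ∈ Finset.range (N + 1), (d i).eval s * Z (s + i) = 0 := by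
    have h1 : AnalyticOnNhd ℝ (fun s => ∑ i ∈ Finset.range (N + 1), (d i).eval s * Z (s + i)) (Ioi 0) := by
      intro s hs
      refine Finset.analyticAt_fun_sum _ fun i _ => (hpoly _ _).mul (hshift i s ?_)
      have := Nat.cast_nonneg (α := ℝ) i
      have h0 : 0 < s := hs
      linarith
    have h2 := h1.eqOn_zero_of_preconnected_of_eventuallyEq_zero isPreconnected_Ioi (z₀ := max σ1 0 + 1)
      (by simp only [mem_Ioi]; have := le_max_right σ1 0; linarith) ?_
    · intro s hs; exact h2 hs
    · have : ∀ᶠ s in 𝓝 (max σ1 0 + 1), σ1 < s := lt_mem_nhds (by have := le_max_left σ1 0; linarith)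
      filter_upwards [this] with s hs
      exact hrec s hs.le
  set G : ℝ → ℝ := fun s => - ∑ i ∈ Finset.range N, (d (i + 1)).eval s * Z (s + ((i + 1 : ℕ) : ℝ)) with hG
  have hGan : AnalyticAt ℝ G 0 := by
    refine AnalyticAt.neg (Finset.analyticAt_fun_sum _ fun i _ => (hpoly _ _).mul (hshift (i + 1) 0 ?_))
    push_cast; positivity
  have hGZ : ∀ s > 0, (d 0).eval s * Z s = G s := by
    intro s hs
    have := hall s hs
    rw [Finset.sum_range_succ'] at this
    simp only [Nat.cast_zero, add_zero] at this
    rw [hG]; simp only; linarith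
  obtain ⟨e, he, hnd⟩ := Polynomial.exists_eq_pow_rootMultiplicity_mul_and_not_dvd (d 0) hd 0
  set m := Polynomial.rootMultiplicity 0 (d 0)
  have he0 : e.eval 0 ≠ 0 := by
    intro h0
    exact hnd (Polynomial.dvd_iff_isRoot.2 h0)
  have hds : ∀ s, (d 0).eval s = s ^ m * e.eval s := by
    intro s; rw [he]; simp
  have hecont : Tendsto (fun s => e.eval s) (𝓝[>] 0) (𝓝 (e.eval 0)) :=
    (e.continuous.tendsto 0).mono_left nhdsWithin_le_nhds
  have hord : (m : ℕ∞) ≤ analyticOrderAt G 0 := by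
    by_contra hcon
    rw [not_le] at hcon
    obtain ⟨k, hk⟩ := ENat.ne_top_iff_exists.1 hcon.ne_top
    rw [← hk] at hcon
    have hkm : k < m := by exact_mod_cast hcon
    obtain ⟨g, hg, hg0, hge⟩ := (hGan.analyticOrderAt_eq_natCast).1 hk.symm
    have h1 : Tendsto g (𝓝[>] 0) (𝓝 (g 0)) := hg.continuousAt.tendsto.mono_left nhdsWithin_le_nhds
    have h2 : Tendsto g (𝓝[>] 0) (𝓝 (0 ^ (m - k) * e.eval 0 * z0)) := by
      have h3 : Tendsto (fun s : ℝ => s ^ (m - k) * e.eval s * Z s) (𝓝[>] 0) (𝓝 (0 ^ (m - k) * e.eval 0 * z0)) :=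
        ((((continuous_pow (M := ℝ) (m - k)).tendsto 0).mono_left nhdsWithin_le_nhds).mul hecont).mul hlim
      refine h3.congr' ?_
      filter_upwards [hge.filter_mono nhdsWithin_le_nhds, self_mem_nhdsWithin] with s hs hs0
      have hs0 : 0 < s := hs0
      have h4 := hGZ s hs0
      rw [hs, hds, sub_zero, smul_eq_mul] at h4
      have h5 : s ^ m = s ^ k * s ^ (m - k) := by rw [← pow_add]; congr 1; omega
      rw [h5] at h4
      have h6 : s ^ k ≠ 0 := (pow_pos hs0 k).ne'
      apply mul_left_cancel₀ h6
      linarith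
    rw [zero_pow (by omega), zero_mul, zero_mul] at h2
    exact hg0 (tendsto_nhds_unique h1 h2)
  obtain ⟨g, hg, hge⟩ := (natCast_le_analyticOrderAt hGan).1 hord
  set H : ℝ → ℝ := fun s => g s / e.eval s
  have hH : AnalyticAt ℝ H 0 := hg.div (hpoly e 0) he0
  have hZH : ∀ᶠ s in 𝓝[>] (0:ℝ), Z s = H s := by
    have h7 : ∀ᶠ s in 𝓝 (0:ℝ), e.eval s ≠ 0 := e.continuous.continuousAt.eventually_ne he0
    filter_upwards [hge.filter_mono nhdsWithin_le_nhds, self_mem_nhdsWithin, h7.filter_mono nhdsWithin_le_nhds] with s hs hs0 hes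
    have hs0 : 0 < s := hs0
    have h4 := hGZ s hs0
    rw [hs, hds, sub_zero, smul_eq_mul] at h4
    have h6 : s ^ m ≠ 0 := (pow_pos hs0 m).ne'
    show Z s = g s / e.eval s
    rw [eq_div_iff hes]
    apply mul_left_cancel₀ h6
    linarith
  have hH0 : H 0 = z0 := by
    have h1 : Tendsto H (𝓝[>] 0) (𝓝 (H 0)) := hH.continuousAt.tendsto.mono_left nhdsWithin_le_nhds
    exact tendsto_nhds_unique h1 (hlim.congr' hZH)
  obtain ⟨K, hK⟩ := hH.differentiableAt.isBigO_sub.bound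
  refine ⟨K, ?_⟩
  filter_upwards [hZH, hK.filter_mono nhdsWithin_le_nhds, self_mem_nhdsWithin] with s h1 h2 hs0
  have hs0 : 0 < s := hs0
  rw [h1, ← hH0]
  simpa [Real.norm_eq_abs, abs_of_pos hs0] using h2

theorem tail_core {Ω : Type*} [MeasurableSpace Ω] (μ : Measure Ω) [IsFiniteMeasure μ] (X : Ω → ℝ) (hX : Measurable X)
    (hX0 : ∀ ω, X ω ≤ 0) (N : ℕ) (c : Fin N → Polynomial ℝ) (hc : c ≠ 0) (σ0 : ℝ)
    (hrec : ∀ σ ≥ σ0, ∑ j : Fin N, (c j).eval σ * mgf X μ (σ + (j : ℕ)) = 0) :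
    ∃ K : ℝ, ∀ k : ℕ, 1 ≤ k → μ.real {ω | X ω ≤ - (k * Real.log 2)} ≤ K / k := by
  classical
  have hexp : ∀ s : ℝ, 0 ≤ s → ∀ ω, Real.exp (s * X ω) ≤ 1 := by
    intro s hs ω
    rw [Real.exp_le_one_iff]
    exact mul_nonpos_of_nonneg_of_nonpos hs (hX0 ω)
  have hIntg : ∀ s : ℝ, 0 ≤ s → Integrable (fun ω => Real.exp (s * X ω)) μ := by
    intro s hs
    refine Integrable.of_bound (by fun_prop) 1 (Eventually.of_forall fun ω => ?_)
    rw [Real.norm_eq_abs, Real.abs_exp]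
    exact hexp s hs ω
  have hZ : AnalyticOnNhd ℝ (mgf X μ) (Ioi 0) := by
    refine analyticOnNhd_mgf.mono ?_
    rw [← interior_Ici]
    exact interior_mono fun s hs => hIntg s hs
  have hlim : Tendsto (mgf X μ) (𝓝[>] 0) (𝓝 (mgf X μ 0)) := by
    unfold mgf
    refine tendsto_integral_filter_of_dominated_convergence (fun _ => 1) ?_ ?_ (integrable_const _) ?_
    · exact Eventually.of_forall fun s => by fun_prop
    · filter_upwards [self_mem_nhdsWithin] with s hs
      refine Eventually.of_forall fun ω => ?_
      rw [Real.norm_eq_abs, Real.abs_exp]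
      exact hexp s (le_of_lt hs) ω
    · refine Eventually.of_forall fun ω => ?_
      have : Continuous (fun s : ℝ => Real.exp (s * X ω)) := by fun_prop
      exact (this.tendsto 0).mono_left nhdsWithin_le_nhds
  let c' : ℕ → Polynomial ℝ := fun j => if h : j < N then c ⟨j, h⟩ else 0
  have hc' : ∃ j, c' j ≠ 0 := by
    obtain ⟨j, hj⟩ := Function.ne_iff.1 hc
    refine ⟨j, ?_⟩
    simpa [c'] using hj
  set j0 := Nat.find hc' with hj0
  have hmin : ∀ j < j0, c' j = 0 := fun j hj => by
    have := Nat.find_min hc' hj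
    simpa using this
  have hrec' : ∀ s ≥ σ0 + j0, ∑ i ∈ Finset.range (N + 1), ((c' (j0 + i)).comp (Polynomial.X - Polynomial.C (j0 : ℝ))).eval s * mgf X μ (s + i) = 0 := by
    intro s hs
    have h1 := hrec (s - j0) (by linarith)
    have h2 : ∑ j : Fin N, (c j).eval (s - j0) * mgf X μ (s - j0 + (j : ℕ)) = ∑ j ∈ Finset.range N, (c' j).eval (s - j0) * mgf X μ (s - j0 + (j : ℕ)) := by
      rw [Finset.sum_range]
      refine Finset.sum_congr rfl fun j _ => ?_
      simp [c']
    have h3 : ∑ j ∈ Finset.range N, (c' j).eval (s - j0) * mgf X μ (s - j0 + (j : ℕ)) = ∑ j ∈ Finset.range (j0 + (N + 1)), (c' j).eval (s - j0) * mgf X μ (s - j0 + (j : ℕ)) := by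
      refine Finset.sum_subset (fun j hj => ?_) fun j _ hj => ?_
      · simp only [Finset.mem_range] at hj ⊢; omega
      · simp only [Finset.mem_range] at hj
        simp [c', hj]
    rw [h2, h3, Finset.sum_range_add, Finset.sum_eq_zero (s := Finset.range j0), zero_add] at h1
    · rw [← h1]
      refine Finset.sum_congr rfl fun i _ => ?_
      rw [Polynomial.eval_comp]
      simp only [Polynomial.eval_sub, Polynomial.eval_X, Polynomial.eval_C]
      congr 2
      push_cast; ring
    · intro j hj
      rw [hmin j (Finset.mem_range.1 hj)]; simp
  obtain ⟨K, hK⟩ := an_core (mgf X μ) hZ (fun i => (c' (j0 + i)).comp (Polynomial.X - Polynomial.C (j0 : ℝ))) (by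
    intro h0
    have h1 : c' j0 ≠ 0 := Nat.find_spec hc'
    apply h1
    have h2 := congrArg (fun p => p.comp (Polynomial.X + Polynomial.C (j0 : ℝ))) h0
    simpa [Polynomial.comp_assoc] using h2) N _ hrec' _ hlim
  obtain ⟨ε, hε, hKε⟩ := Metric.eventually_nhds_iff.1 (eventually_nhdsWithin_iff.1 hK)
  have hM : 0 ≤ μ.real univ := measureReal_nonneg
  refine ⟨2 * |K| + μ.real univ / ε, fun k hk => ?_⟩
  have hk0 : (0 : ℝ) < k := by exact_mod_cast hk
  rw [le_div_iff₀ hk0]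
  by_cases hkε : (k : ℝ)⁻¹ < ε
  · have hs0 : (0:ℝ) < (k:ℝ)⁻¹ := by positivity
    have h1 := hKε (y := (k : ℝ)⁻¹) (by simpa [abs_of_pos hk0] using hkε) hs0
    have h2 := mul_meas_ge_le_integral_of_nonneg (μ := μ) (f := fun ω => Real.exp (0 * X ω) - Real.exp ((k:ℝ)⁻¹ * X ω))
      (Eventually.of_forall fun ω => by
        have := hexp _ hs0.le ω
        simp only [Pi.zero_apply, zero_mul, Real.exp_zero]; linarith) ((hIntg 0 le_rfl).sub (hIntg _ hs0.le)) (1 / 2)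
    rw [integral_sub (hIntg 0 le_rfl) (hIntg _ hs0.le)] at h2
    have h3 : {ω | X ω ≤ - (k * Real.log 2)} ⊆ {ω | 1 / 2 ≤ Real.exp (0 * X ω) - Real.exp ((k:ℝ)⁻¹ * X ω)} := by
      intro ω hω
      simp only [mem_ofPred_eq, zero_mul, Real.exp_zero] at hω ⊢
      have h4 : (k:ℝ)⁻¹ * X ω ≤ - Real.log 2 := by
        rw [inv_mul_le_iff₀ hk0]; linarith
      have h5 := Real.exp_le_exp.2 h4
      rw [Real.exp_neg, Real.exp_log (by norm_num)] at h5
      linarith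
    have h6 := measureReal_mono (μ := μ) h3
    have h7 : mgf X μ 0 - mgf X μ (k:ℝ)⁻¹ ≤ |K| * (k:ℝ)⁻¹ := by
      have := neg_abs_le (mgf X μ (k:ℝ)⁻¹ - mgf X μ 0)
      have h8 := mul_le_mul_of_nonneg_right (le_abs_self K) hs0.le
      linarith
    unfold mgf at h7
    have h9 : μ.real {ω | X ω ≤ - (k * Real.log 2)} ≤ 2 * (|K| * (k:ℝ)⁻¹) := by linarith
    have h10 := mul_le_mul_of_nonneg_right h9 hk0.le
    have h11 : 2 * (|K| * (k:ℝ)⁻¹) * k = 2 * |K| := by field_simp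
    have : 0 ≤ μ.real univ / ε := by positivity
    linarith
  · rw [not_lt, le_inv_comm₀ hε hk0] at hkε
    have h1 := measureReal_mono (μ := μ) (subset_univ {ω | X ω ≤ - (k * Real.log 2)})
    have h2 := mul_le_mul h1 hkε hk0.le hM
    rw [div_eq_mul_inv]
    have := abs_nonneg K
    linarith

end PeriodAux


namespace PeriodAux
open MvPolynomial MeasureTheory Set Filter Topology ProbabilityTheory

section
variable {n : ℕ} {U : Set (Fin n → ℝ)} {A B : MvPolynomial (Fin n) ℝ}

theorem tail (h : Dat U A B) (p0 : MvPolynomial (Fin n) ℝ) (hp : ∀ x ∈ U, 0 ≤ eval x p0)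
    (hIntg : IntegrableOn (fun x => eval x p0 / eval x A) U) :
    ∃ K : ℝ, ∀ k : ℕ, 1 ≤ k → ∫ x in U ∩ {x | eval x A / eval x B ≤ (2 ^ k)⁻¹}, eval x p0 / eval x A ≤ K / k := by
  have hc : ∀ p : MvPolynomial (Fin n) ℝ, Measurable (fun x : Fin n → ℝ => eval x p) := fun p =>
    (MvPolynomial.continuous_eval p).measurable
  have hmU := h.isOpen.measurableSet
  have hmh : Measurable (fun x : Fin n → ℝ => eval x p0 / eval x A) := (hc p0).div (hc A)
  set μ := (volume.restrict U).withDensity (fun x => ENNReal.ofReal (eval x p0 / eval x A)) with hμ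
  have : IsFiniteMeasure μ := isFiniteMeasure_withDensity_ofReal hIntg.hasFiniteIntegral
  set X : (Fin n → ℝ) → ℝ := fun x => min 0 (Real.log (eval x A / eval x B)) with hX
  have hXm : Measurable X := measurable_const.min (Real.measurable_log.comp ((hc A).div (hc B)))
  have hI : ∀ F : (Fin n → ℝ) → ℝ, ∫ x, F x ∂μ = ∫ x in U, eval x p0 / eval x A * F x := by
    intro F
    rw [hμ, integral_withDensity_eq_integral_toReal_smul hmh.ennreal_ofReal (Eventually.of_forall fun x => ENNReal.ofReal_lt_top)]
    refine setIntegral_congr_fun hmU fun x hx => ?_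
    simp only [smul_eq_mul]
    rw [ENNReal.toReal_ofReal (div_nonneg (hp x hx) (h.pos x hx).le)]
  have hXU : ∀ x ∈ U, X x = Real.log (eval x A / eval x B) := by
    intro x hx
    refine min_eq_right (Real.log_nonpos (h.phi_pos hx).le ((h.phi_le x).trans ?_))
    exact inv_le_one_of_one_le₀ (by nlinarith [sq_nonneg ‖x‖])
  have hmgf : ∀ s, mgf X μ s = ∫ x, psi U A B p0 1 (s - 1) x := by
    intro s
    unfold mgf psi
    rw [hI, integral_indicator hmU]
    refine setIntegral_congr_fun hmU fun x hx => ?_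
    have hΦ := h.phi_pos hx
    have ha := h.pos x hx
    have hb : 0 < eval x B := by linarith [h.one_le x]
    rw [hXU x hx, mul_comm s, ← Real.rpow_def_of_pos hΦ, Real.rpow_sub_one hΦ.ne']
    field_simp
  obtain ⟨N, c, σ0, hc0, hrec⟩ := recurrence h p0
  obtain ⟨K, hK⟩ := tail_core μ X hXm (fun x => min_le_left _ _) N c hc0 σ0 (by
    intro σ hσ
    simpa only [hmgf] using hrec σ hσ)
  refine ⟨K, fun k hk => le_trans (le_of_eq ?_) (hK k hk)⟩
  have hmS : MeasurableSet {x | X x ≤ - (k * Real.log 2)} := measurableSet_le hXm measurable_const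
  rw [← integral_indicator_one hmS, hI]
  have : ∀ x, eval x p0 / eval x A * {x | X x ≤ - (k * Real.log 2)}.indicator (1 : (Fin n → ℝ) → ℝ) x = {x | X x ≤ - (k * Real.log 2)}.indicator (fun x => eval x p0 / eval x A) x := by
    intro x
    by_cases hx : x ∈ {x | X x ≤ - (k * Real.log 2)}
    · simp only [indicator_of_mem hx, Pi.one_apply, mul_one]
    · simp only [indicator_of_notMem hx, mul_zero]
  simp only [this]
  rw [setIntegral_indicator hmS]
  congr 2
  ext x
  simp only [mem_inter_iff, mem_ofPred_eq]
  refine and_congr_right fun hx => ?_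
  rw [hXU x hx, ← Real.log_pow, ← Real.log_inv, Real.log_le_log_iff (h.phi_pos hx) (by positivity)]

end
end PeriodAux


namespace PeriodAux
open MeasureTheory Set Filter Topology

/-- grid coordinate -/
noncomputable def gc (k l a : ℕ) : ℝ := (a : ℝ) / 2 ^ l - 2 ^ k

theorem riemann {n : ℕ} (F : (Fin n → ℝ) → ℝ) (Λ : ℝ) (hF : ∀ x y, |F y - F x| ≤ Λ * ‖y - x‖) (k l : ℕ) :
    |(∫ x in Set.pi univ (fun _ : Fin n => Ico (-(2:ℝ) ^ k) (2 ^ k)), F x) -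
      ∑ t ∈ Finset.range ((2 ^ (k + l + 1)) ^ n), F (fun i => gc k l (t / (2 ^ (k + l + 1)) ^ (i : ℕ) % 2 ^ (k + l + 1))) * ((2 ^ l) ^ n)⁻¹|
      ≤ |Λ| * (2 ^ (k + 1)) ^ n * (2 ^ l)⁻¹ := by
  set M := 2 ^ (k + l + 1) with hM
  have hFc : Continuous F := by
    refine (LipschitzWith.of_dist_le_mul (K := Real.toNNReal |Λ|) fun x y => ?_).continuous
    rw [Real.dist_eq, dist_eq_norm, Real.coe_toNNReal _ (abs_nonneg _)]
    exact (hF y x).trans (mul_le_mul_of_nonneg_right (le_abs_self _) (norm_nonneg _))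
  let cube : (Fin n → Fin M) → Set (Fin n → ℝ) := fun a => Set.pi univ (fun i => Ico (gc k l (a i)) (gc k l (a i + 1)))
  have h2l : (0 : ℝ) < 2 ^ l := by positivity
  have hgc : ∀ (a : ℕ) (y : ℝ), y ∈ Ico (gc k l a) (gc k l (a + 1)) ↔ 0 ≤ (y + 2 ^ k) * 2 ^ l ∧ a = ⌊(y + 2 ^ k) * 2 ^ l⌋₊ := by
    intro a y
    unfold gc
    rw [mem_Ico, sub_le_iff_le_add, div_le_iff₀ h2l, lt_sub_iff_add_lt, lt_div_iff₀ h2l]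
    constructor
    · rintro ⟨h1, h2⟩
      have h0 : 0 ≤ (y + 2 ^ k) * 2 ^ l := (Nat.cast_nonneg a).trans h1
      refine ⟨h0, ?_⟩
      symm
      rw [Nat.floor_eq_iff h0]
      push_cast at h2
      exact ⟨h1, h2⟩
    · rintro ⟨h0, h1⟩
      have := (Nat.floor_eq_iff h0).1 h1.symm
      push_cast
      exact this
  have hunion : Set.pi univ (fun _ : Fin n => Ico (-(2:ℝ) ^ k) (2 ^ k)) = ⋃ a, cube a := by
    ext x
    simp only [cube, mem_iUnion, Set.mem_pi, mem_univ, true_imp_iff, hgc]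
    constructor
    · intro hx
      have h0 : ∀ i, 0 ≤ (x i + 2 ^ k) * 2 ^ l := fun i => mul_nonneg (by linarith [(hx i).1]) h2l.le
      refine ⟨fun i => ⟨⌊(x i + 2 ^ k) * 2 ^ l⌋₊, ?_⟩, fun i => ⟨h0 i, rfl⟩⟩
      rw [Nat.floor_lt (h0 i), hM]
      push_cast
      have : x i + 2 ^ k < 2 * 2 ^ k := by linarith [(hx i).2]
      calc (x i + 2 ^ k) * 2 ^ l < 2 * 2 ^ k * 2 ^ l := mul_lt_mul_of_pos_right this h2l
        _ = _ := by ring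
    · rintro ⟨a, ha⟩ i
      obtain ⟨h0, h1⟩ := ha i
      have h2 : ⌊(x i + 2 ^ k) * 2 ^ l⌋₊ < M := by rw [← h1]; exact (a i).2
      rw [Nat.floor_lt h0, hM] at h2
      push_cast at h2
      have h3 : (x i + 2 ^ k) * 2 ^ l < 2 * 2 ^ k * 2 ^ l := by rw [show (2:ℝ) * 2 ^ k * 2 ^ l = 2 ^ (k + l + 1) by ring]; exact h2
      have h4 := lt_of_mul_lt_mul_right h3 h2l.le
      have h5 := nonneg_of_mul_nonneg_left h0 h2l
      exact ⟨by linarith, by linarith⟩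
  have hdisj : Pairwise (Function.onFun Disjoint cube) := by
    intro a b hab
    rw [Function.onFun, Set.disjoint_left]
    intro x hxa hxb
    apply hab
    ext i
    have h1 := ((hgc _ _).1 (hxa i (mem_univ i))).2
    have h2 := ((hgc _ _).1 (hxb i (mem_univ i))).2
    rw [h1, h2]
  have hmeas : ∀ a, MeasurableSet (cube a) := fun a => MeasurableSet.univ_pi fun i => measurableSet_Ico
  have hside : ∀ a : ℕ, gc k l (a + 1) - gc k l a = (2 ^ l)⁻¹ := by
    intro a; unfold gc; push_cast; field_simp; ring
  have hvol : ∀ a, volume.real (cube a) = ((2 ^ l) ^ n)⁻¹ := by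
    intro a
    rw [measureReal_def, Real.volume_pi_Ico_toReal]
    · simp [hside]
    · intro i
      have := hside (a i)
      have : (0:ℝ) < (2 ^ l)⁻¹ := by positivity
      linarith
  have hsub : ∀ a, cube a ⊆ Icc (fun i => gc k l (a i)) (fun i => gc k l (a i + 1)) := by
    intro a x hx
    exact ⟨fun i => (hx i (mem_univ i)).1, fun i => (hx i (mem_univ i)).2.le⟩
  have hIntg : ∀ a, IntegrableOn F (cube a) := fun a => (hFc.integrableOn_Icc).mono_set (hsub a)
  have hfin : ∀ a, volume (cube a) < ⊤ := fun a => (measure_mono (hsub a)).trans_lt isCompact_Icc.measure_lt_top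
  rw [hunion, integral_iUnion_fintype hmeas hdisj hIntg]
  have hsum : ∑ t ∈ Finset.range (M ^ n), F (fun i => gc k l (t / M ^ (i : ℕ) % M)) * ((2 ^ l) ^ n)⁻¹ = ∑ a : Fin n → Fin M, F (fun i => gc k l (a i)) * ((2 ^ l) ^ n)⁻¹ := by
    rw [Finset.sum_range]
    rw [← Equiv.sum_comp (finFunctionFinEquiv (m := M) (n := n)).symm]
    refine Finset.sum_congr rfl fun t _ => ?_
    simp only [finFunctionFinEquiv_symm_apply_val]
  rw [hsum, ← Finset.sum_sub_distrib]
  refine (Finset.abs_sum_le_sum_abs _ _).trans ?_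
  have hterm : ∀ a ∈ (Finset.univ : Finset (Fin n → Fin M)), |(∫ x in cube a, F x) - F (fun i => gc k l (a i)) * ((2 ^ l) ^ n)⁻¹| ≤ |Λ| * (2 ^ l)⁻¹ * ((2 ^ l) ^ n)⁻¹ := by
    intro a _
    have e : ∫ x in cube a, (F x - F (fun i => gc k l (a i))) = (∫ x in cube a, F x) - F (fun i => gc k l (a i)) * ((2 ^ l) ^ n)⁻¹ := by
      rw [integral_sub (hIntg a) (integrableOn_const (hfin a).ne), setIntegral_const, hvol, smul_eq_mul, mul_comm]
    rw [← e, ← hvol a, ← Real.norm_eq_abs]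
    refine norm_setIntegral_le_of_norm_le_const (hfin a) fun x hx => ?_
    refine (hF _ _).trans ?_
    refine (mul_le_mul_of_nonneg_right (le_abs_self _) (norm_nonneg _)).trans (mul_le_mul_of_nonneg_left ?_ (abs_nonneg _))
    rw [pi_norm_le_iff_of_nonneg (by positivity)]
    intro i
    have h1 := hx i (mem_univ i)
    have h2 := hside (a i)
    rw [Pi.sub_apply, Real.norm_eq_abs, abs_of_nonneg (by linarith [h1.1])]
    linarith [h1.2]
  refine (Finset.sum_le_card_nsmul _ _ _ hterm).trans (le_of_eq ?_)
  simp only [Finset.card_univ, Fintype.card_pi, Fintype.card_fin, Finset.prod_const, nsmul_eq_mul, hM]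
  push_cast
  have : ((2:ℝ) ^ (k + l + 1)) ^ n = (2 ^ (k + 1)) ^ n * (2 ^ l) ^ n := by rw [← mul_pow]; congr 1; ring
  rw [this]
  field_simp

end PeriodAux


namespace PeriodAux
open MvPolynomial MeasureTheory Set Filter Topology

section
variable {n : ℕ} {U : Set (Fin n → ℝ)} {A B : MvPolynomial (Fin n) ℝ}

theorem lip_div_max {E : Type*} [SeminormedAddCommGroup E] (G Ψ : E → ℝ) (K L L' δ : ℝ) (hδ : 0 < δ) (hδ1 : δ ≤ 1)
    (hK : ∀ x, |G x| ≤ K) (hL : ∀ x y, |G y - G x| ≤ L * ‖y - x‖) (hL' : ∀ x y, |Ψ y - Ψ x| ≤ L' * ‖y - x‖) (x y : E) :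
    |G y / max (Ψ y) δ - G x / max (Ψ x) δ| ≤ (L + K * L') / δ ^ 2 * ‖y - x‖ := by
  have hy : δ ≤ max (Ψ y) δ := le_max_right _ _
  have hx : δ ≤ max (Ψ x) δ := le_max_right _ _
  have hm : |max (Ψ x) δ - max (Ψ y) δ| ≤ L' * ‖y - x‖ := by
    refine (abs_max_sub_max_le_abs _ _ _).trans ?_
    rw [abs_sub_comm]; exact hL' x y
  generalize max (Ψ y) δ = a at *
  generalize max (Ψ x) δ = b at *
  have ha0 : 0 < a := hδ.trans_le hy
  have hb0 : 0 < b := hδ.trans_le hx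
  have e : G y / a - G x / b = (G y - G x) / a + G x * (b - a) / (a * b) := by field_simp; ring
  have hK0 : 0 ≤ K := (abs_nonneg _).trans (hK x)
  have hLd : 0 ≤ L * ‖y - x‖ := (abs_nonneg _).trans (hL x y)
  have hLd' : 0 ≤ L' * ‖y - x‖ := (abs_nonneg _).trans (hL' x y)
  rw [e]
  have h1 : |(G y - G x) / a| ≤ L * ‖y - x‖ / δ ^ 2 := by
    rw [abs_div, abs_of_pos ha0]
    refine div_le_div₀ hLd (hL x y) (by positivity) ?_
    nlinarith
  have h2 : |G x * (b - a) / (a * b)| ≤ K * (L' * ‖y - x‖) / δ ^ 2 := by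
    rw [abs_div, abs_mul, abs_of_pos (mul_pos ha0 hb0)]
    refine div_le_div₀ (by positivity) (mul_le_mul (hK x) hm (abs_nonneg _) hK0) (by positivity) ?_
    nlinarith
  refine (abs_add_le _ _).trans ((add_le_add h1 h2).trans (le_of_eq ?_))
  ring

/-- truncated integrand -/
noncomputable def Fk (U : Set (Fin n → ℝ)) (A B p0 : MvPolynomial (Fin n) ℝ) (m k : ℕ) (x : Fin n → ℝ) : ℝ :=
  psi U A B p0 1 ((m : ℝ) - 1) x / max (psi U A B 1 0 m x) ((2 ^ (m * k))⁻¹)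

theorem Fk_mem (h : Dat U A B) (p0 : MvPolynomial (Fin n) ℝ) (m k : ℕ) {x : Fin n → ℝ} (hx : x ∈ U) :
    Fk U A B p0 m k x = (eval x p0 / eval x A) * ((eval x A / eval x B) ^ m / max ((eval x A / eval x B) ^ m) ((2 ^ k)⁻¹ ^ m)) := by
  have ha := h.pos x hx
  have hb : 0 < eval x B := by linarith [h.one_le x]
  have hΦ := h.phi_pos hx
  unfold Fk psi
  simp only [indicator_of_mem hx, pow_zero, map_one, inv_one, one_mul, Real.rpow_natCast, pow_one]
  rw [Real.rpow_sub_one hΦ.ne', Real.rpow_natCast, inv_pow, ← pow_mul, mul_comm k m]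
  field_simp

theorem Fk_notMem (p0 : MvPolynomial (Fin n) ℝ) (m k : ℕ) {x : Fin n → ℝ} (hx : x ∉ U) :
    Fk U A B p0 m k x = 0 := by
  unfold Fk psi
  simp [indicator_of_notMem hx]

theorem trunc (h : Dat U A B) (p0 : MvPolynomial (Fin n) ℝ) (hp : ∀ x ∈ U, 0 ≤ eval x p0)
    (hIntg : IntegrableOn (fun x => eval x p0 / eval x A) U) (m k : ℕ) :
    |(∫ x in U, eval x p0 / eval x A) - ∫ x in Set.pi univ (fun _ : Fin n => Ico (-(2:ℝ) ^ k) (2 ^ k)), Fk U A B p0 m k x| ≤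
      ∫ x in U ∩ {x | eval x A / eval x B ≤ (2 ^ k)⁻¹}, eval x p0 / eval x A := by
  have hc : ∀ p : MvPolynomial (Fin n) ℝ, Measurable (fun x : Fin n → ℝ => eval x p) := fun p =>
    (MvPolynomial.continuous_eval p).measurable
  have hmU := h.isOpen.measurableSet
  set Q := Set.pi univ (fun _ : Fin n => Ico (-(2:ℝ) ^ k) (2 ^ k)) with hQ
  have hmQ : MeasurableSet Q := MeasurableSet.univ_pi fun i => measurableSet_Ico
  set S := {x | eval x A / eval x B ≤ (2 ^ k)⁻¹} with hS
  have hmS : MeasurableSet S := measurableSet_le ((hc A).div (hc B)) measurable_const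
  have hFm : Measurable (Fk U A B p0 m k) := (psi_measurable h _ _ _).div ((psi_measurable h _ _ _).max measurable_const)
  set u := U.indicator (fun x => eval x p0 / eval x A) with hu
  have hu0 : ∀ x, 0 ≤ u x := fun x => indicator_nonneg (fun x hx => div_nonneg (hp x hx) (h.pos x hx).le) x
  have hF0 : ∀ x, 0 ≤ Fk U A B p0 m k x ∧ Fk U A B p0 m k x ≤ u x := by
    intro x
    by_cases hx : x ∈ U
    · rw [Fk_mem h p0 m k hx, hu, indicator_of_mem hx]
      have h1 : 0 ≤ eval x p0 / eval x A := div_nonneg (hp x hx) (h.pos x hx).le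
      have hΦ := h.phi_pos hx
      have h2 : 0 < (eval x A / eval x B) ^ m := pow_pos hΦ m
      have h3 := le_max_left ((eval x A / eval x B) ^ m) ((2 ^ k)⁻¹ ^ m)
      constructor
      · positivity
      · refine mul_le_of_le_one_right h1 ?_
        rw [div_le_one (h2.trans_le h3)]; exact h3
    · rw [Fk_notMem p0 m k hx, hu, indicator_of_notMem hx]; simp
  have hui : Integrable u := (integrable_indicator_iff hmU).2 hIntg
  have hv0 : ∀ x, 0 ≤ Q.indicator (Fk U A B p0 m k) x ∧ Q.indicator (Fk U A B p0 m k) x ≤ u x := by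
    intro x
    by_cases hx : x ∈ Q
    · rw [indicator_of_mem hx]; exact hF0 x
    · rw [indicator_of_notMem hx]; exact ⟨le_rfl, hu0 x⟩
  have hvi : Integrable (Q.indicator (Fk U A B p0 m k)) := by
    refine hui.mono' (hFm.indicator hmQ).aestronglyMeasurable (Eventually.of_forall fun x => ?_)
    rw [Real.norm_eq_abs, abs_of_nonneg (hv0 x).1]; exact (hv0 x).2
  rw [← integral_indicator hmU, ← integral_indicator hmQ, ← integral_indicator (hmU.inter hmS), ← hu, ← integral_sub hui hvi]
  have hwi : Integrable ((U ∩ S).indicator (fun x => eval x p0 / eval x A)) :=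
    (integrable_indicator_iff (hmU.inter hmS)).2 (hIntg.mono_set inter_subset_left)
  rw [abs_of_nonneg (integral_nonneg fun x => sub_nonneg.2 (hv0 x).2)]
  refine integral_mono (hui.sub hvi) hwi fun x => ?_
  simp only
  by_cases hx : x ∈ U
  swap
  · rw [indicator_of_notMem (show x ∉ U ∩ S from fun hh => hx hh.1)]
    have : u x = 0 := by rw [hu, indicator_of_notMem hx]
    linarith [(hv0 x).1]
  by_cases hxS : x ∈ S
  · rw [indicator_of_mem (show x ∈ U ∩ S from ⟨hx, hxS⟩), hu, indicator_of_mem hx]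
    linarith [(hv0 x).1]
  · rw [indicator_of_notMem (show x ∉ U ∩ S from fun hh => hxS hh.2)]
    have hxS' : (2 ^ k)⁻¹ < eval x A / eval x B := not_le.1 hxS
    have hxQ : x ∈ Q := by
      have h1 := hxS'.trans_le (h.phi_le x)
      rw [inv_lt_inv₀ (by positivity) (by positivity)] at h1
      have h2 : ‖x‖ < 2 ^ k := by
        have h3 : (1:ℝ) ≤ 2 ^ k := one_le_pow₀ (by norm_num)
        nlinarith [norm_nonneg x]
      intro i _
      have h4 := (norm_le_pi_norm x i).trans_lt h2
      rw [Real.norm_eq_abs, abs_lt] at h4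
      exact ⟨h4.1.le, h4.2⟩
    rw [indicator_of_mem hxQ, Fk_mem h p0 m k hx, hu, indicator_of_mem hx, max_eq_left (pow_le_pow_left₀ (by positivity) hxS'.le _), div_self (pow_pos (h.phi_pos hx) m).ne']
    simp

theorem approx (h : Dat U A B) (p0 : MvPolynomial (Fin n) ℝ) (hp : ∀ x ∈ U, 0 ≤ eval x p0)
    (hIntg : IntegrableOn (fun x => eval x p0 / eval x A) U) :
    ∃ (m : ℕ) (K : ℝ), 1 ≤ m ∧ ∀ k : ℕ, 1 ≤ k → ∀ l, l = (n + 2 * m + 1) * k →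
      |(∫ x in U, eval x p0 / eval x A) - ∑ t ∈ Finset.range ((2 ^ (k + l + 1)) ^ n),
        Fk U A B p0 m k (fun i => gc k l (t / (2 ^ (k + l + 1)) ^ (i : ℕ) % 2 ^ (k + l + 1))) * ((2 ^ l) ^ n)⁻¹| ≤ K / k := by
  set m : ℕ := p0.totalDegree + A.totalDegree + B.totalDegree + 3 with hm
  have hmr : (m : ℝ) = p0.totalDegree + A.totalDegree + B.totalDegree + 3 := by rw [hm]; push_cast; ring
  have h1 := Nat.cast_nonneg (α := ℝ) p0.totalDegree
  have h2 := Nat.cast_nonneg (α := ℝ) A.totalDegree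
  have h3 := Nat.cast_nonneg (α := ℝ) B.totalDegree
  obtain ⟨K1, hK1⟩ := psi_bdd h p0 1 ((m:ℝ) - 1) (by linarith)
  obtain ⟨L1, hL1⟩ := psi_lip h p0 1 ((m:ℝ) - 1) (by linarith)
  obtain ⟨L2, hL2⟩ := psi_lip h 1 0 m (by simp only [totalDegree_one, Nat.cast_zero]; linarith)
  obtain ⟨K0, hK0⟩ := tail h p0 hp hIntg
  refine ⟨m, K0 + |L1 + K1 * L2| * 2 ^ n, by omega, fun k hk l hl => ?_⟩
  have hk0 : (0 : ℝ) < k := by exact_mod_cast hk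
  have ht := (trunc h p0 hp hIntg m k).trans (hK0 k hk)
  have hr := riemann (Fk U A B p0 m k) _ (lip_div_max _ _ K1 L1 L2 ((2 ^ (m * k))⁻¹) (by positivity) (inv_le_one_of_one_le₀ (one_le_pow₀ (by norm_num))) hK1 hL1 hL2) k l
  have hr2 : |(L1 + K1 * L2) / ((2 ^ (m * k))⁻¹) ^ 2| * (2 ^ (k + 1)) ^ n * (2 ^ l)⁻¹ ≤ |L1 + K1 * L2| * 2 ^ n / k := by
    rw [abs_div, abs_of_nonneg (a := (((2:ℝ) ^ (m * k))⁻¹) ^ 2) (by positivity)]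
    have e : |L1 + K1 * L2| / (((2:ℝ) ^ (m * k))⁻¹) ^ 2 * (2 ^ (k + 1)) ^ n * (2 ^ l)⁻¹ = |L1 + K1 * L2| * 2 ^ n / 2 ^ k := by
      rw [hl]
      field_simp
      ring
    rw [e]
    refine div_le_div_of_nonneg_left (by positivity) hk0 ?_
    exact_mod_cast Nat.lt_two_pow_self.le
  have := abs_sub_le (∫ x in U, eval x p0 / eval x A) (∫ x in Set.pi univ (fun _ : Fin n => Ico (-(2:ℝ) ^ k) (2 ^ k)), Fk U A B p0 m k x) (∑ t ∈ Finset.range ((2 ^ (k + l + 1)) ^ n),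
        Fk U A B p0 m k (fun i => gc k l (t / (2 ^ (k + l + 1)) ^ (i : ℕ) % 2 ^ (k + l + 1))) * ((2 ^ l) ^ n)⁻¹)
  rw [add_div]
  linarith [hr.trans hr2]

end
end PeriodAux


namespace PeriodAux
open MvPolynomial MeasureTheory Set Filter Topology

theorem eval_map_cast {n : ℕ} (P : MvPolynomial (Fin n) ℚ) (v : Fin n → ℚ) :
    eval (fun i => ((v i : ℚ) : ℝ)) (map (algebraMap ℚ ℝ) P) = ((eval v P : ℚ) : ℝ) := by
  rw [eval_map]
  have := aeval_algebraMap_apply (B := ℝ) v P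
  simpa [aeval_def, Function.comp_def] using this

/-- basic open set -/
def bset {n : ℕ} (qs : List (MvPolynomial (Fin n) ℚ)) : Set (Fin n → ℝ) :=
  {x | ∀ Q ∈ qs, 0 < eval x (map (algebraMap ℚ ℝ) Q)}

theorem mem_bset_cast {n : ℕ} (qs : List (MvPolynomial (Fin n) ℚ)) (v : Fin n → ℚ) :
    (fun i => ((v i : ℚ) : ℝ)) ∈ bset qs ↔ ∀ Q ∈ qs, 0 < eval v Q := by
  unfold bset
  simp only [mem_ofPred_eq, eval_map_cast, Rat.cast_pos]

/-- rational version of psi -/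
noncomputable def psiQ {n : ℕ} (qs : List (MvPolynomial (Fin n) ℚ)) (a b p : MvPolynomial (Fin n) ℚ) (r m : ℕ) (v : Fin n → ℚ) : ℚ :=
  open Classical in if ∀ Q ∈ qs, 0 < eval v Q then eval v p * (eval v b ^ r)⁻¹ * (eval v a / eval v b) ^ m else 0

theorem psiQ_cast {n : ℕ} (qs : List (MvPolynomial (Fin n) ℚ)) (a b p : MvPolynomial (Fin n) ℚ) (r m : ℕ) (v : Fin n → ℚ) :
    ((psiQ qs a b p r m v : ℚ) : ℝ) = psi (bset qs) (map (algebraMap ℚ ℝ) a) (map (algebraMap ℚ ℝ) b) (map (algebraMap ℚ ℝ) p) r m (fun i => ((v i : ℚ) : ℝ)) := by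
  unfold psiQ psi
  split_ifs with h
  · rw [indicator_of_mem ((mem_bset_cast qs v).2 h)]
    simp only [eval_map_cast, Real.rpow_natCast]
    push_cast
    rfl
  · rw [indicator_of_notMem (fun h' => h ((mem_bset_cast qs v).1 h'))]
    simp

section
variable {α : Type} [Primcodable α]

theorem primrecPred_qs {n : ℕ} (qs : List (MvPolynomial (Fin n) ℚ)) {v : α → Fin n → ℚ} (hv : ∀ i, CompQ (fun x => v x i)) :
    PrimrecPred (fun x => ∀ Q ∈ qs, 0 < eval (v x) Q) := by
  induction qs with
  | nil => exact (PrimrecPred.of_eq (p := fun x : α => (0:ℕ) = 0) (Primrec.eq.comp (Primrec.const 0) (Primrec.const 0)) (fun x => by simp))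
  | cons q qs ih =>
    refine (((CompQ.const 0).primrecPred_lt (CompQ.eval q hv)).and ih).of_eq fun x => ?_
    simp

theorem CompQ.psiQ {n : ℕ} (qs : List (MvPolynomial (Fin n) ℚ)) (a b p : MvPolynomial (Fin n) ℚ) (r m : ℕ) {v : α → Fin n → ℚ} (hv : ∀ i, CompQ (fun x => v x i)) :
    CompQ (fun x => psiQ qs a b p r m (v x)) := by
  classical
  unfold PeriodAux.psiQ
  exact CompQ.ite (primrecPred_qs qs hv) (((CompQ.eval p hv).mul ((CompQ.eval b hv).pow r).inv).mul (((CompQ.eval a hv).div (CompQ.eval b hv)).pow m)) (CompQ.const 0)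

end

theorem appr_core {n : ℕ} (qs : List (MvPolynomial (Fin n) ℚ)) (a b p : MvPolynomial (Fin n) ℚ)
    (h : Dat (bset qs) (map (algebraMap ℚ ℝ) a) (map (algebraMap ℚ ℝ) b))
    (hp : ∀ x ∈ bset qs, 0 ≤ eval x (map (algebraMap ℚ ℝ) p))
    (hIntg : IntegrableOn (fun x => eval x (map (algebraMap ℚ ℝ) p) / eval x (map (algebraMap ℚ ℝ) a)) (bset qs)) :
    Appr (∫ x in bset qs, eval x (map (algebraMap ℚ ℝ) p) / eval x (map (algebraMap ℚ ℝ) a)) := by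
  obtain ⟨m, K, hm, hK⟩ := approx h _ hp hIntg
  let l : ℕ → ℕ := fun k => (n + 2 * m + 1) * k
  let M : ℕ → ℕ := fun k => 2 ^ (k + l k + 1)
  let v : ℕ × ℕ → Fin n → ℚ := fun y i => ((y.2 / M y.1 ^ (i : ℕ) % M y.1 : ℕ) : ℚ) / ((2 ^ l y.1 : ℕ) : ℚ) - ((2 ^ y.1 : ℕ) : ℚ)
  let f : ℕ × ℕ → ℚ := fun y => psiQ qs a b p 1 (m - 1) (v y) / max (psiQ qs a b 1 0 m (v y)) (((2 ^ (m * y.1) : ℕ) : ℚ)⁻¹) * (((2 ^ l y.1) ^ n : ℕ) : ℚ)⁻¹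
  have hl : Primrec l := Primrec.nat_mul.comp (Primrec.const _) Primrec.id
  have hM : Primrec M := primrec_pow (Primrec.const 2) (Primrec.succ.comp (Primrec.nat_add.comp Primrec.id hl))
  have hv : ∀ i, CompQ (fun y => v y i) := by
    intro i
    refine ((CompQ.natCast ?_).div (CompQ.natCast ?_)).sub (CompQ.natCast ?_)
    · exact Primrec.nat_mod.comp (Primrec.nat_div.comp Primrec.snd (primrec_pow (hM.comp Primrec.fst) (Primrec.const _))) (hM.comp Primrec.fst)
    · exact primrec_pow (Primrec.const 2) (hl.comp Primrec.fst)
    · exact primrec_pow (Primrec.const 2) Primrec.fst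
  have hf : CompQ f := by
    refine ((CompQ.psiQ qs a b p 1 (m - 1) hv).div ((CompQ.psiQ qs a b 1 0 m hv).max (CompQ.natCast ?_).inv)).mul (CompQ.natCast ?_).inv
    · exact primrec_pow (Primrec.const 2) (Primrec.nat_mul.comp (Primrec.const _) Primrec.fst)
    · exact primrec_pow (primrec_pow (Primrec.const 2) (hl.comp Primrec.fst)) (Primrec.const n)
  refine ⟨fun k => ∑ t ∈ Finset.range (M k ^ n), f (k, t), CompQ.sum hf (primrec_pow hM (Primrec.const n)), K, fun k hk => ?_⟩
  have := hK k hk (l k) rfl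
  convert this using 3
  push_cast
  refine Finset.sum_congr rfl fun t _ => ?_
  have hpt : (fun i : Fin n => gc k (l k) (t / (2 ^ (k + l k + 1)) ^ (i : ℕ) % 2 ^ (k + l k + 1))) = fun i => ((v (k, t) i : ℚ) : ℝ) := by
    funext i
    simp only [gc, v, M]
    push_cast
    rfl
  rw [hpt]
  unfold Fk
  have e1 := psiQ_cast qs a b p 1 (m - 1) (v (k, t))
  have e2 := psiQ_cast qs a b 1 0 m (v (k, t))
  rw [Nat.cast_sub hm, Nat.cast_one] at e1
  rw [map_one] at e2
  rw [← e1, ← e2]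
  simp only [f]
  push_cast
  rfl

end PeriodAux


namespace PeriodAux
open MvPolynomial MeasureTheory Set Filter Topology

theorem volume_zeros {n : ℕ} (P : MvPolynomial (Fin n) ℝ) (hP : P ≠ 0) :
    volume {x : Fin n → ℝ | eval x P = 0} = 0 := by
  induction n with
  | zero =>
    have : {x : Fin 0 → ℝ | eval x P = 0} = ∅ := by
      ext x
      simp only [mem_ofPred_eq, mem_empty_iff_false, iff_false]
      intro h
      apply hP
      rw [eq_C_of_isEmpty P] at h ⊢
      rw [eval_C] at h
      rw [h, C_0]
    rw [this, measure_empty]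
  | succ n ih =>
    set q := finSuccEquiv ℝ n P with hq
    have hq0 : q ≠ 0 := by
      rw [hq]
      simpa using hP
    have hlc := ih q.leadingCoeff (by simpa using hq0)
    have hmp := (volume_preserving_piFinSuccAbove (fun _ : Fin (n + 1) => ℝ) 0).symm
    have hmeas : MeasurableSet {x : Fin (n + 1) → ℝ | eval x P = 0} :=
      (isClosed_eq (continuous_eval P) continuous_const).measurableSet
    rw [← hmp.measure_preimage hmeas.nullMeasurableSet]
    have hm2 := (MeasurableEquiv.piFinSuccAbove (fun _ : Fin (n + 1) => ℝ) 0).symm.measurable hmeas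
    rw [Measure.volume_eq_prod, Measure.prod_apply_symm hm2]
    rw [lintegral_eq_zero_of_ae_eq_zero]
    have : ∀ᵐ s : Fin n → ℝ, eval s q.leadingCoeff ≠ 0 := by
      rw [ae_iff]; simpa using hlc
    filter_upwards [this] with s hs
    have hne : Polynomial.map (eval s) q ≠ 0 := by
      intro h
      apply hs
      have := congrArg (fun r => Polynomial.coeff r q.natDegree) h
      simpa [Polynomial.coeff_map] using this
    refine measure_mono_null (t := {y | (Polynomial.map (eval s) q).IsRoot y}) ?_ ?_
    · intro y hy
      have hy' : eval (Fin.cons y s : Fin (n + 1) → ℝ) P = 0 := by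
        simpa [MeasurableEquiv.piFinSuccAbove, Fin.insertNthEquiv] using hy
      rw [eval_eq_eval_mv_eval'] at hy'
      exact hy'
    · exact (Polynomial.finite_setOfPred_isRoot hne).measure_zero _

theorem ae_ne {n : ℕ} (P : MvPolynomial (Fin n) ℚ) (hP : P ≠ 0) :
    ∀ᵐ x : Fin n → ℝ, eval x (map (algebraMap ℚ ℝ) P) ≠ 0 := by
  rw [ae_iff]
  have := volume_zeros (map (algebraMap ℚ ℝ) P) (by
    intro h
    exact hP (map_injective (algebraMap ℚ ℝ) (algebraMap ℚ ℝ).injective (by simpa using h)))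
  simpa using this

theorem isOpen_bset {n : ℕ} (qs : List (MvPolynomial (Fin n) ℚ)) : IsOpen (bset qs) := by
  induction qs with
  | nil => simp [bset]
  | cons q qs ih =>
    have : bset (q :: qs) = {x | 0 < eval x (map (algebraMap ℚ ℝ) q)} ∩ bset qs := by
      ext x; simp [bset]
    rw [this]
    exact (isOpen_lt continuous_const (continuous_eval _)).inter ih

theorem closure_bset {n : ℕ} (qs : List (MvPolynomial (Fin n) ℚ)) (x) (hx : x ∈ closure (bset qs)) :
    ∀ Q ∈ qs, 0 ≤ eval x (map (algebraMap ℚ ℝ) Q) := by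
  intro Q hQ
  have hc : IsClosed {x | 0 ≤ eval x (map (algebraMap ℚ ℝ) Q)} := isClosed_le continuous_const (continuous_eval _)
  exact closure_minimal (fun y hy => (hy Q hQ).le) hc hx

theorem appr_piece {n : ℕ} (F g : MvPolynomial (Fin n) ℚ) (qs : List (MvPolynomial (Fin n) ℚ))
    (hIntg : IntegrableOn (fun x => eval x (map (algebraMap ℚ ℝ) F) / eval x (map (algebraMap ℚ ℝ) g)) (bset ((F * g) :: qs))) :
    Appr (∫ x in bset ((F * g) :: qs), eval x (map (algebraMap ℚ ℝ) F) / eval x (map (algebraMap ℚ ℝ) g)) := by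
  set U := bset ((F * g) :: qs) with hU
  let a : MvPolynomial (Fin n) ℚ := (F * g * qs.prod) ^ 2
  let p : MvPolynomial (Fin n) ℚ := F * (g * (F * qs.prod) ^ 2)
  obtain ⟨K, hK0, hK⟩ := eval_bound (map (algebraMap ℚ ℝ) a) _ le_rfl
  obtain ⟨N, hN⟩ := exists_nat_ge K
  let b : MvPolynomial (Fin n) ℚ := C ((N : ℚ) + 1) * (1 + ∑ i, X i ^ 2) ^ ((map (algebraMap ℚ ℝ) a).totalDegree + 1)
  have heb : ∀ x, eval x (map (algebraMap ℚ ℝ) b) = ((N : ℝ) + 1) * (1 + ∑ i, x i ^ 2) ^ ((map (algebraMap ℚ ℝ) a).totalDegree + 1) := by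
    intro x
    simp [b, map_sum]
  have hprod : ∀ x, eval x (map (algebraMap ℚ ℝ) qs.prod) = (qs.map fun Q => eval x (map (algebraMap ℚ ℝ) Q)).prod := by
    intro x
    have := map_list_prod ((eval x).comp (map (algebraMap ℚ ℝ))) qs
    exact this
  have hUprod : ∀ x ∈ U, 0 < eval x (map (algebraMap ℚ ℝ) qs.prod) := by
    intro x hx
    rw [hprod]
    refine List.prod_pos ?_
    intro y hy
    obtain ⟨Q, hQ, rfl⟩ := List.mem_map.1 hy
    exact hx Q (by simp [hQ])
  have hUF : ∀ x ∈ U, 0 < eval x (map (algebraMap ℚ ℝ) F) * eval x (map (algebraMap ℚ ℝ) g) := by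
    intro x hx
    simpa using hx (F * g) (by simp)
  have hea : ∀ x, eval x (map (algebraMap ℚ ℝ) a) = (eval x (map (algebraMap ℚ ℝ) F) * eval x (map (algebraMap ℚ ℝ) g) * eval x (map (algebraMap ℚ ℝ) qs.prod)) ^ 2 := by
    intro x; simp [a]
  have hep : ∀ x, eval x (map (algebraMap ℚ ℝ) p) = eval x (map (algebraMap ℚ ℝ) F) * (eval x (map (algebraMap ℚ ℝ) g) * (eval x (map (algebraMap ℚ ℝ) F) * eval x (map (algebraMap ℚ ℝ) qs.prod)) ^ 2) := by
    intro x; simp [p]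
  have hsum : ∀ x : Fin n → ℝ, 1 + ‖x‖ ^ 2 ≤ 1 + ∑ i, x i ^ 2 := by
    intro x
    have h0 : 0 ≤ ∑ i, x i ^ 2 := Finset.sum_nonneg fun i _ => sq_nonneg _
    have : ‖x‖ ≤ √(∑ i, x i ^ 2) := by
      rw [pi_norm_le_iff_of_nonneg (Real.sqrt_nonneg _)]
      intro i
      refine Real.le_sqrt_of_sq_le ?_
      rw [Real.norm_eq_abs, sq_abs]
      exact Finset.single_le_sum (f := fun i => x i ^ 2) (fun i _ => sq_nonneg _) (Finset.mem_univ i)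
    have h2 : ‖x‖ ^ 2 ≤ √(∑ i, x i ^ 2) ^ 2 := pow_le_pow_left₀ (norm_nonneg _) this 2
    rw [Real.sq_sqrt h0] at h2
    linarith
  have hdat : Dat U (map (algebraMap ℚ ℝ) a) (map (algebraMap ℚ ℝ) b) := by
    refine ⟨isOpen_bset _, ?_, ?_, ?_, ?_⟩
    · intro x hx
      rw [hea]
      have := mul_pos (hUF x hx) (hUprod x hx)
      positivity
    · intro x hx hx'
      have h1 := closure_bset _ x hx
      have h2 : ∃ Q ∈ (F * g) :: qs, eval x (map (algebraMap ℚ ℝ) Q) = 0 := by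
        by_contra! hcon
        exact hx' fun Q hQ => lt_of_le_of_ne (h1 Q hQ) (hcon Q hQ).symm
      obtain ⟨Q, hQ, h0⟩ := h2
      rw [hea]
      rcases List.mem_cons.1 hQ with rfl | hQ
      · have : eval x (map (algebraMap ℚ ℝ) F) * eval x (map (algebraMap ℚ ℝ) g) = 0 := by simpa using h0
        rw [this]; simp
      · have : eval x (map (algebraMap ℚ ℝ) qs.prod) = 0 := by
          rw [hprod]
          exact List.prod_eq_zero (List.mem_map.2 ⟨Q, hQ, h0⟩)
        rw [this]; simp
    · intro x
      rw [heb]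
      have h0 : 0 ≤ ∑ i, x i ^ 2 := Finset.sum_nonneg fun i _ => sq_nonneg _
      have h1 : (1:ℝ) ≤ (1 + ∑ i, x i ^ 2) ^ ((map (algebraMap ℚ ℝ) a).totalDegree + 1) := one_le_pow₀ (by linarith)
      have h2 : (1:ℝ) ≤ (N:ℝ) + 1 := by linarith [Nat.cast_nonneg (α := ℝ) N]
      exact one_le_mul_of_one_le_of_one_le h2 h1
    · intro x
      rw [heb]
      have h1 : eval x (map (algebraMap ℚ ℝ) a) ≤ K * (1 + ‖x‖ ^ 2) ^ (map (algebraMap ℚ ℝ) a).totalDegree := (le_abs_self _).trans (hK x)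
      calc eval x (map (algebraMap ℚ ℝ) a) * (1 + ‖x‖ ^ 2) ≤ K * (1 + ‖x‖ ^ 2) ^ (map (algebraMap ℚ ℝ) a).totalDegree * (1 + ‖x‖ ^ 2) :=
            mul_le_mul_of_nonneg_right h1 (by positivity)
        _ = K * (1 + ‖x‖ ^ 2) ^ ((map (algebraMap ℚ ℝ) a).totalDegree + 1) := by rw [pow_succ]; ring
        _ ≤ _ := by
          refine mul_le_mul (by linarith) (pow_le_pow_left₀ (by positivity) (hsum x) _) (by positivity) (by positivity)
  have hcongr : ∀ x ∈ U, eval x (map (algebraMap ℚ ℝ) F) / eval x (map (algebraMap ℚ ℝ) g) = eval x (map (algebraMap ℚ ℝ) p) / eval x (map (algebraMap ℚ ℝ) a) := by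
    intro x hx
    have h1 := hUF x hx
    have h2 := (hUprod x hx).ne'
    have h3 : eval x (map (algebraMap ℚ ℝ) F) ≠ 0 := fun h => by simp [h] at h1
    have h4 : eval x (map (algebraMap ℚ ℝ) g) ≠ 0 := fun h => by simp [h] at h1
    rw [hea, hep]
    field_simp
  have hUm : MeasurableSet U := (isOpen_bset _).measurableSet
  rw [setIntegral_congr_fun hUm hcongr]
  refine appr_core _ a b p hdat ?_ (hIntg.congr_fun hcongr hUm)
  intro x hx
  rw [hep, ← mul_assoc]
  have := hUF x hx
  positivity

theorem appr_main {n : ℕ} (f g : MvPolynomial (Fin n) ℚ) (ps : List (MvPolynomial (Fin n) ℚ))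
    (hIntg : IntegrableOn (fun v : Fin n → ℝ => eval v (map (algebraMap ℚ ℝ) f) / eval v (map (algebraMap ℚ ℝ) g))
      {v : Fin n → ℝ | ∀ P ∈ ps, 0 ≤ eval v (map (algebraMap ℚ ℝ) P)}) :
    Appr (∫ v in {v : Fin n → ℝ | ∀ P ∈ ps, 0 ≤ eval v (map (algebraMap ℚ ℝ) P)}, eval v (map (algebraMap ℚ ℝ) f) / eval v (map (algebraMap ℚ ℝ) g)) := by
  classical
  set qs := ps.filter (fun P => P ≠ 0) with hqs
  set S : Set (Fin n → ℝ) := {v : Fin n → ℝ | ∀ P ∈ ps, 0 ≤ eval v (map (algebraMap ℚ ℝ) P)} with hS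
  have hne : ∀ᵐ x : Fin n → ℝ, ∀ P ∈ qs, eval x (map (algebraMap ℚ ℝ) P) ≠ 0 := by
    have : ∀ᵐ x : Fin n → ℝ, ∀ P : {P // P ∈ qs.toFinset}, eval x (map (algebraMap ℚ ℝ) P.1) ≠ 0 := by
      rw [ae_all_iff]
      rintro ⟨P, hP⟩
      refine ae_ne P ?_
      simp [hqs] at hP
      exact hP.2
    filter_upwards [this] with x hx P hP
    exact hx ⟨P, by simpa using hP⟩
  have hsub : bset qs ⊆ S := by
    intro x hx P hP
    by_cases h : P = 0
    · simp [h]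
    · exact (hx P (by simp [hqs, hP, h])).le
  have hae : S =ᵐ[volume] bset qs := by
    filter_upwards [hne] with x hx
    apply propext
    refine ⟨fun h P hP => lt_of_le_of_ne (h P ?_) (hx P hP).symm, fun h => hsub h⟩
    exact (List.mem_filter.1 hP).1
  set G : (Fin n → ℝ) → ℝ := fun v => eval v (map (algebraMap ℚ ℝ) f) / eval v (map (algebraMap ℚ ℝ) g) with hG
  set Up := bset ((f * g) :: qs) with hUp
  set Um := bset ((-f * g) :: qs) with hUm
  have mUp : MeasurableSet Up := (isOpen_bset _).measurableSet
  have mUm : MeasurableSet Um := (isOpen_bset _).measurableSet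
  have hUpS : Up ⊆ bset qs := fun x hx P hP => hx P (by simp [hP])
  have hUmS : Um ⊆ bset qs := fun x hx P hP => hx P (by simp [hP])
  have memp : ∀ x ∈ Up, 0 < eval x (map (algebraMap ℚ ℝ) f) * eval x (map (algebraMap ℚ ℝ) g) := fun x hx => by
    simpa using hx (f * g) (by simp)
  have memm : ∀ x ∈ Um, eval x (map (algebraMap ℚ ℝ) f) * eval x (map (algebraMap ℚ ℝ) g) < 0 := fun x hx => by
    simpa using hx (-f * g) (by simp)
  have hdisj : Disjoint Up Um := by
    rw [Set.disjoint_left]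
    intro x h1 h2
    exact lt_asymm (memp x h1) (memm x h2)
  have hintq : IntegrableOn G (bset qs) := hIntg.mono_set hsub
  have e1 : ∫ v in S, G v = ∫ v in bset qs, G v := setIntegral_congr_set hae
  have e2 : ∫ v in bset qs, G v = ∫ v in Up ∪ Um, G v := by
    refine setIntegral_eq_of_subset_of_forall_sdiff_eq_zero (isOpen_bset _).measurableSet (union_subset hUpS hUmS) ?_
    rintro x ⟨hx, hx'⟩
    have h0 : eval x (map (algebraMap ℚ ℝ) f) * eval x (map (algebraMap ℚ ℝ) g) = 0 := by
      by_contra hcon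
      apply hx'
      rcases lt_or_gt_of_ne hcon with h | h
      · right
        intro P hP
        rcases List.mem_cons.1 hP with rfl | hP
        · simpa using h
        · exact hx P hP
      · left
        intro P hP
        rcases List.mem_cons.1 hP with rfl | hP
        · simpa using h
        · exact hx P hP
    rcases mul_eq_zero.1 h0 with h | h <;> simp only [hG, h, zero_div, div_zero]
  have hG' : ∀ v, eval v (map (algebraMap ℚ ℝ) (-f)) / eval v (map (algebraMap ℚ ℝ) g) = - G v := by
    intro v; simp [hG, neg_div]
  have hp := appr_piece f g qs (hintq.mono_set hUpS)
  have hm := appr_piece (-f) g qs (by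
    simp only [hG']
    exact (hintq.mono_set hUmS).neg)
  have key := hp.sub hm
  simp only [hG'] at key
  rw [e1, e2, setIntegral_union hdisj mUm (hintq.mono_set hUpS) (hintq.mono_set hUmS)]
  rw [integral_neg, sub_neg_eq_add] at key
  exact key

end PeriodAux


theorem period_isComputableReal (x : ℝ) (hx : IsPeriod x) :
    IsComputableReal x := by
  obtain ⟨n, f, g, ps, hIntg, rfl⟩ := hx
  have haev : ∀ (v : Fin n → ℝ) (P : MvPolynomial (Fin n) ℚ),
      MvPolynomial.aeval v P = MvPolynomial.eval v (MvPolynomial.map (algebraMap ℚ ℝ) P) := by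
    intro v P
    rw [MvPolynomial.aeval_def, MvPolynomial.eval_map]
  simp only [haev] at hIntg ⊢
  exact (PeriodAux.appr_main f g ps hIntg).exists_computable
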